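/- arXiv:1110.1095 — 2 statements merged into one kernel-verified Lean document; each statement's English description precedes it below -/
import Mathlib

section
/- Let k be a field of characteristic zero, X an r × s matrix of indeterminates with r < s, R = k[X], I the ideal generated by the maximal (r × r) minors of X, and d = r(s−r) + 1. Then the local cohomology module H^d_I(R) is nonzero, and H^i_I(R) = 0 for all i > d. -/
/-- The ideal of `t × t` minors of a matrix over a commutative ring. -/
noncomputable def minorsIdeal {T α β : Type*} [CommRing T] (M : Matrix α β T) (t : ℕ) :
    Ideal T :=
  Ideal.span (Set.range fun p : (Fin t ↪ α) × (Fin t ↪ β) =>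
    (M.submatrix (⇑p.1) (⇑p.2)).det)

universe u

section HomologyClass

open CategoryTheory Limits Opposite

variable {R : Type u} [CommRing R] {ι : Type*} {c : ComplexShape ι}

/-- The homology class `x` is represented by the chain `y`. -/
def Represents (K : HomologicalComplex (ModuleCat.{u} R) c) (n : ι) (y : K.X n)
    (x : K.homology n) : Prop :=
  ∃ z : K.cycles n, K.iCycles n z = y ∧ K.homologyπ n z = x

theorem Represents.exists_left (K : HomologicalComplex (ModuleCat.{u} R) c) (n : ι)
    (x : K.homology n) : ∃ y, Represents K n y x := by
  obtain ⟨z, hz⟩ := (ModuleCat.epi_iff_surjective (K.homologyπ n)).1 inferInstance x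
  exact ⟨_, z, rfl, hz⟩

theorem Represents.d_eq_zero {K : HomologicalComplex (ModuleCat.{u} R) c} {n : ι} {y : K.X n}
    {x : K.homology n} (h : Represents K n y x) (m : ι) : K.d n m y = 0 := by
  obtain ⟨z, rfl, -⟩ := h
  rw [← ModuleCat.comp_apply, K.iCycles_d]
  rfl

theorem Represents.exists_right (K : HomologicalComplex (ModuleCat.{u} R) c) (n m : ι)
    (hm : c.next n = m) (y : K.X n) (hy : K.d n m y = 0) : ∃ x, Represents K n y x := by
  let k : ModuleCat.of R (LinearMap.ker (K.d n m).hom) ⟶ K.X n :=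
    ModuleCat.ofHom (LinearMap.ker (K.d n m).hom).subtype
  have hk : k ≫ K.d n m = 0 := by
    ext a
    exact a.2
  refine ⟨_, K.liftCycles k m hm hk ⟨y, hy⟩, ?_, rfl⟩
  rw [← ModuleCat.comp_apply, K.liftCycles_i]
  rfl

theorem Represents.eq_zero_iff {K : HomologicalComplex (ModuleCat.{u} R) c} {n : ι} (m : ι)
    (hm : c.prev n = m) {y : K.X n} {x : K.homology n} (h : Represents K n y x) :
    x = 0 ↔ ∃ w, K.d m n w = y := by
  obtain ⟨z, rfl, rfl⟩ := h
  have hex : (ShortComplex.mk (K.toCycles m n) (K.homologyπ n) (by simp)).Exact :=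
    ShortComplex.exact_of_g_is_cokernel _ (K.homologyIsCokernel m n hm)
  rw [ShortComplex.moduleCat_exact_iff] at hex
  constructor
  · intro hz
    obtain ⟨w, hw⟩ := hex z hz
    refine ⟨w, ?_⟩
    rw [← hw]
    change _ = (K.toCycles m n ≫ K.iCycles n) w
    rw [K.toCycles_i]
  · rintro ⟨w, hw⟩
    have : z = K.toCycles m n w := by
      apply (ModuleCat.mono_iff_injective (K.iCycles n)).1 inferInstance
      rw [← hw]
      change _ = (K.toCycles m n ≫ K.iCycles n) w
      rw [K.toCycles_i]
    rw [this]
    change (K.toCycles m n ≫ K.homologyπ n) w = 0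
    simp

theorem Represents.map {K K' : HomologicalComplex (ModuleCat.{u} R) c} (φ : K ⟶ K') {n : ι}
    {y : K.X n} {x : K.homology n} (h : Represents K n y x) :
    Represents K' n (φ.f n y) (HomologicalComplex.homologyMap φ n x) := by
  obtain ⟨z, rfl, rfl⟩ := h
  refine ⟨HomologicalComplex.cyclesMap φ n z, ?_, ?_⟩
  · rw [← ModuleCat.comp_apply, ← ModuleCat.comp_apply, HomologicalComplex.cyclesMap_i]
  · rw [← ModuleCat.comp_apply, ← ModuleCat.comp_apply, HomologicalComplex.homologyπ_naturality]

end HomologyClass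

section ExtComparison

open CategoryTheory Limits Opposite

variable {R : Type u} [CommRing R]

/-- The map of Hom-complexes induced by a map of chain complexes. -/
noncomputable def linearYonedaObjMap {P Q : ChainComplex (ModuleCat.{u} R) ℕ} (φ : P ⟶ Q)
    (Y : ModuleCat.{u} R) : Q.linearYonedaObj R Y ⟶ P.linearYonedaObj R Y :=
  (HomologicalComplex.unopFunctor _ _).map
    ((((linearYoneda R (ModuleCat.{u} R)).obj Y).rightOp.mapHomologicalComplex _).map φ).op

theorem Iso.inv_comp_eq_comp_inv_of_comp_hom {C : Type*} [Category C] {A B A' B' : C}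
    (e : A ≅ B) (e' : A' ≅ B') {f : A ⟶ A'} {g : B ⟶ B'} (h : f ≫ e'.hom = e.hom ≫ g) :
    e.inv ≫ f = g ≫ e'.inv := by
  rw [Iso.inv_comp_eq, ← Category.assoc, Iso.eq_comp_inv, h]

theorem comp_comp_eq_of_squares {C : Type*} [Category C] {A₁ A₂ A₃ B₁ B₂ B₃ : C}
    {f₁ : A₁ ⟶ B₁} {f₂ : A₂ ⟶ B₂} {f₃ : A₃ ⟶ B₃} {p : A₁ ⟶ A₂} {p' : A₂ ⟶ A₃} {q : B₁ ⟶ B₂}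
    {q' : B₂ ⟶ B₃} (h : f₁ ≫ q = p ≫ f₂) (h' : f₂ ≫ q' = p' ≫ f₃) :
    f₁ ≫ q ≫ q' = (p ≫ p') ≫ f₃ := by
  rw [← Category.assoc, h, Category.assoc, h', Category.assoc]

theorem isoExt_hom_naturality {X X' : ModuleCat.{u} R} (f : X ⟶ X')
    (P : ProjectiveResolution X) (Q : ProjectiveResolution X') (φ : P.complex ⟶ Q.complex)
    (comm : φ.f 0 ≫ Q.π.f 0 = P.π.f 0 ≫ f) (n : ℕ) (Y : ModuleCat.{u} R) :
    ((Ext R (ModuleCat.{u} R) n).map f.op).app Y ≫ (P.isoExt n Y).hom =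
      (Q.isoExt n Y).hom ≫ HomologicalComplex.homologyMap (linearYonedaObjMap φ Y) n := by
  have h := ProjectiveResolution.isoLeftDerivedObj_inv_naturality f P Q φ comm
    ((linearYoneda R (ModuleCat.{u} R)).obj Y).rightOp n
  have h1 := HomologicalComplex.homologyOp_hom_naturality (linearYonedaObjMap φ Y) n
  have h2 := Iso.inv_comp_eq_comp_inv_of_comp_hom
    (HomologicalComplex.homologyOp (P.complex.linearYonedaObj R Y) n)
    (HomologicalComplex.homologyOp (Q.complex.linearYonedaObj R Y) n) h1
  exact comp_comp_eq_of_squares (congrArg Quiver.Hom.unop h) (congrArg Quiver.Hom.unop h2)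

/-- An element of `Ext` is represented by the cocycle `y` on a projective resolution. -/
def ExtRepresents {X Y : ModuleCat.{u} R} (P : ProjectiveResolution X) (n : ℕ)
    (y : P.complex.X n ⟶ Y) (x : ((Ext R (ModuleCat.{u} R) n).obj (op X)).obj Y) : Prop :=
  Represents (P.complex.linearYonedaObj R Y) n y ((P.isoExt n Y).hom x)

theorem ExtRepresents.map {X X' Y : ModuleCat.{u} R} {f : X ⟶ X'}
    {P : ProjectiveResolution X} {Q : ProjectiveResolution X'}
    (φ : ProjectiveResolution.Hom P Q f) {n : ℕ} {y : Q.complex.X n ⟶ Y}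
    {x : ((Ext R (ModuleCat.{u} R) n).obj (op X')).obj Y} (h : ExtRepresents Q n y x) :
    ExtRepresents P n (φ.hom.f n ≫ y) (((Ext R (ModuleCat.{u} R) n).map f.op).app Y x) := by
  have := Represents.map (linearYonedaObjMap φ.hom Y) h
  rw [← ModuleCat.comp_apply, ← isoExt_hom_naturality f P Q φ.hom
    (by have := φ.hom_f_zero_comp_π_f_zero; exact this) n Y] at this
  exact this

theorem ExtRepresents.exists_left {X Y : ModuleCat.{u} R} (P : ProjectiveResolution X) (n : ℕ)
    (x : ((Ext R (ModuleCat.{u} R) n).obj (op X)).obj Y) :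
    ∃ y : P.complex.X n ⟶ Y, ExtRepresents P n y x :=
  Represents.exists_left (P.complex.linearYonedaObj R Y) n ((P.isoExt n Y).hom x)

theorem ExtRepresents.exists_right {X Y : ModuleCat.{u} R} (P : ProjectiveResolution X) (n : ℕ)
    (y : P.complex.X n ⟶ Y) (hy : P.complex.d (n + 1) n ≫ y = 0) :
    ∃ x, ExtRepresents P n y x := by
  obtain ⟨x, hx⟩ := Represents.exists_right (P.complex.linearYonedaObj R Y) n (n + 1) (by simp)
    y hy
  refine ⟨(P.isoExt n Y).inv x, ?_⟩
  rw [ExtRepresents, ← ModuleCat.comp_apply, Iso.inv_hom_id]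
  exact hx

theorem ExtRepresents.comp_eq_zero {X Y : ModuleCat.{u} R} {P : ProjectiveResolution X} {n : ℕ}
    {y : P.complex.X n ⟶ Y} {x : ((Ext R (ModuleCat.{u} R) n).obj (op X)).obj Y}
    (h : ExtRepresents P n y x) : P.complex.d (n + 1) n ≫ y = 0 :=
  Represents.d_eq_zero h (n + 1)

theorem ExtRepresents.eq_zero_iff {X Y : ModuleCat.{u} R} {P : ProjectiveResolution X} {n : ℕ}
    {y : P.complex.X (n + 1) ⟶ Y} {x : ((Ext R (ModuleCat.{u} R) (n + 1)).obj (op X)).obj Y}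
    (h : ExtRepresents P (n + 1) y x) :
    x = 0 ↔ ∃ w : P.complex.X n ⟶ Y, P.complex.d (n + 1) n ≫ w = y := by
  refine Iff.trans ?_ (Represents.eq_zero_iff (K := P.complex.linearYonedaObj R Y) n (by simp) h)
  constructor
  · rintro rfl
    simp
  · intro hx
    have hx' : x = (P.isoExt (n + 1) Y).inv ((P.isoExt (n + 1) Y).hom x) := by
      rw [← ModuleCat.comp_apply, Iso.hom_inv_id]
      rfl
    rw [hx', hx, map_zero]

/-- A family of objects indexed by arrows into `X` kills all of `Ext` of `X` iff it kills all
cocycles on an injective resolution. -/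
theorem forall_ext_exists_map_eq_zero_iff {Y X : ModuleCat.{u} R} (E : InjectiveResolution Y)
    (n : ℕ) {ι : Type*} (X' : ι → ModuleCat.{u} R) (f : ∀ i, X' i ⟶ X) :
    (∀ x : ((Ext R (ModuleCat.{u} R) (n + 1)).obj (op X)).obj Y,
      ∃ i, ((Ext R (ModuleCat.{u} R) (n + 1)).map (f i).op).app Y x = 0) ↔
    ∀ z : X ⟶ E.cocomplex.X (n + 1), z ≫ E.cocomplex.d (n + 1) (n + 2) = 0 →
      ∃ i, ∃ u : X' i ⟶ E.cocomplex.X n, u ≫ E.cocomplex.d n (n + 1) = f i ≫ z := by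
  let P := projectiveResolution X
  let P' := fun i => projectiveResolution (X' i)
  let φ : ∀ i, ProjectiveResolution.Hom (P' i) P (f i) := fun i =>
    { hom := ProjectiveResolution.lift (f i) (P' i) P
      hom_f_zero_comp_π_f_zero := by
        have := ProjectiveResolution.lift_commutes_zero (f i) (P' i) P
        simpa using this }
  have key : ∀ (y : P.complex.X (n + 1) ⟶ Y) (x) (h : ExtRepresents P (n + 1) y x)
      (z : X ⟶ E.cocomplex.X (n + 1)) (hz : z ≫ E.cocomplex.d (n + 1) (n + 2) = 0),
      P.extMk y (n + 2) rfl h.comp_eq_zero = E.extMk z (n + 2) rfl hz →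
      ∀ i, ((Ext R (ModuleCat.{u} R) (n + 1)).map (f i).op).app Y x = 0 ↔
        ∃ u : X' i ⟶ E.cocomplex.X n, u ≫ E.cocomplex.d n (n + 1) = f i ≫ z := by
    intro y x h z hz hyz i
    rw [(h.map (φ i)).eq_zero_iff,
      ← (P' i).extMk_eq_zero_iff _ (n + 2) rfl (h.map (φ i)).comp_eq_zero n rfl,
      ← E.extMk_eq_zero_iff _ (n + 2) rfl (by simp [hz]) n rfl,
      ← ProjectiveResolution.mk₀_comp_extMk y (n + 2) rfl h.comp_eq_zero (φ i),
      ← E.mk₀_comp_extMk _ _ _ hz, hyz]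
  constructor
  · intro H z hz
    obtain ⟨y, hy, hyz⟩ := P.extMk_surjective (E.extMk z (n + 2) rfl hz) (n + 2) rfl
    obtain ⟨x, hx⟩ := ExtRepresents.exists_right P (n + 1) y hy
    obtain ⟨i, hi⟩ := H x
    exact ⟨i, (key y x hx z hz hyz i).1 hi⟩
  · intro H x
    obtain ⟨y, hy⟩ := ExtRepresents.exists_left P (n + 1) x
    obtain ⟨z, hz, hzy⟩ := E.extMk_surjective (P.extMk y (n + 2) rfl hy.comp_eq_zero) (n + 2) rfl
    obtain ⟨i, hi⟩ := H z hz
    exact ⟨i, (key y x hy z hz hzy.symm i).2 hi⟩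

end ExtComparison

section Criterion

open CategoryTheory Limits Opposite

variable {R : Type} [CommRing R]

/-- The transition map `R/J^(t+m) → R/J^t`. -/
noncomputable def quotientPowMap (J : Ideal R) {t t' : ℕ} (h : t ≤ t') :
    ModuleCat.of R (R ⧸ J ^ t') ⟶ ModuleCat.of R (R ⧸ J ^ t) :=
  (localCohomology.ringModIdeals (localCohomology.idealPowersDiagram J)).map (homOfLE h).op

theorem subsingleton_localCohomology_iff_ext (J : Ideal R) (i : ℕ) (M : ModuleCat.{0} R) :
    Subsingleton ((localCohomology J i).obj M) ↔
      ∀ t, ∀ x : ((Ext R (ModuleCat.{0} R) i).obj (op (ModuleCat.of R (R ⧸ J ^ t)))).obj M,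
        ∃ t' : {t' // t ≤ t'},
          ((Ext R (ModuleCat.{0} R) i).map (quotientPowMap J t'.2).op).app M x = 0 := by
  let F := localCohomology.diagram (localCohomology.idealPowersDiagram J) i
  let c := colimit.cocone F
  have hc : IsColimit (((evaluation _ _).obj M).mapCocone c) :=
    isColimitOfPreserves _ (colimit.isColimit F)
  have hsub : Subsingleton ((localCohomology J i).obj M) ↔
      ∀ y : (((evaluation _ _).obj M).mapCocone c).pt, y = 0 :=
    ⟨fun h y => h.elim (α := ((localCohomology J i).obj M)) y 0, fun h =>
      ⟨fun a b => (h a).trans (h b).symm⟩⟩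
  rw [hsub]
  constructor
  · intro H t x
    have hx := (Concrete.isColimit_rep_eq_iff_exists (F ⋙ (evaluation _ _).obj M) hc
      (i := op (op t)) (j := op (op t)) x 0).1 ((H _).trans (map_zero _).symm)
    obtain ⟨k, f, g, hfg⟩ := hx
    refine ⟨⟨k.unop.unop, leOfHom f.unop.unop⟩, ?_⟩
    exact hfg.trans (map_zero _)
  · intro H y
    obtain ⟨t, x, rfl⟩ := Concrete.isColimit_exists_rep _ hc y
    obtain ⟨⟨t', h⟩, hx⟩ := H t.unop.unop x
    have hw := (((evaluation _ _).obj M).mapCocone c).w (homOfLE h).op.op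
    change (((evaluation _ _).obj M).mapCocone c).ι.app t x = 0
    rw [← hw, ModuleCat.comp_apply]
    exact (congrArg _ hx).trans (map_zero _)

/-- The element `x` is killed by some power of the ideal `J`. -/
def IsPowTorsion (J : Ideal R) {N : Type*} [AddCommGroup N] [Module R N] (x : N) : Prop :=
  ∃ t : ℕ, ∀ f ∈ J ^ t, f • x = 0

/-- The homomorphism `R/I → N` sending `1` to an element killed by `I`. -/
noncomputable def quotientHomOfTorsion (I : Ideal R) {N : ModuleCat.{0} R} (x : N)
    (h : ∀ f ∈ I, f • x = 0) : ModuleCat.of R (R ⧸ I) ⟶ N :=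
  ModuleCat.ofHom (Submodule.liftQ I (LinearMap.toSpanSingleton R N x) h)

theorem quotientHomOfTorsion_one (I : Ideal R) {N : ModuleCat.{0} R} (x : N)
    (h : ∀ f ∈ I, f • x = 0) : quotientHomOfTorsion I x h (1 : R ⧸ I) = x :=
  one_smul R x

theorem quotientHom_ext (I : Ideal R) {N : ModuleCat.{0} R} {f g : ModuleCat.of R (R ⧸ I) ⟶ N}
    (h : f (1 : R ⧸ I) = g (1 : R ⧸ I)) : f = g := by
  ext
  exact h

theorem quotientHom_torsion (I : Ideal R) {N : ModuleCat.{0} R} (g : ModuleCat.of R (R ⧸ I) ⟶ N)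
    (f : R) (hf : f ∈ I) : f • g (1 : R ⧸ I) = 0 := by
  rw [← map_smul]
  have : f • (1 : R ⧸ I) = 0 := by
    rw [Algebra.smul_def, mul_one]
    exact Ideal.Quotient.eq_zero_iff_mem.2 hf
  exact (congrArg g this).trans (map_zero _)

theorem subsingleton_localCohomology_iff (J : Ideal R) (n : ℕ) {M : ModuleCat.{0} R}
    (E : InjectiveResolution M) :
    Subsingleton ((localCohomology J (n + 1)).obj M) ↔
      ∀ z : E.cocomplex.X (n + 1), IsPowTorsion J z → E.cocomplex.d (n + 1) (n + 2) z = 0 →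
        ∃ u : E.cocomplex.X n, IsPowTorsion J u ∧ E.cocomplex.d n (n + 1) u = z := by
  rw [subsingleton_localCohomology_iff_ext]
  have h := fun t => forall_ext_exists_map_eq_zero_iff E n
    (fun t' : {t' // t ≤ t'} => ModuleCat.of R (R ⧸ J ^ t'.1)) (fun t' => quotientPowMap J t'.2)
  simp only [h]
  constructor
  · rintro H z ⟨t, ht⟩ hz
    obtain ⟨t', u, hu⟩ := H t (quotientHomOfTorsion _ z ht)
      (quotientHom_ext _ ((congrArg _ (quotientHomOfTorsion_one _ z ht)).trans hz))
    refine ⟨u (1 : R ⧸ J ^ t'.1), ⟨t'.1, quotientHom_torsion _ u⟩, ?_⟩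
    exact (ConcreteCategory.congr_hom hu (1 : R ⧸ J ^ t'.1)).trans
      (quotientHomOfTorsion_one _ z ht)
  · intro H t z hz
    obtain ⟨u, ⟨t', ht'⟩, hu⟩ := H (z (1 : R ⧸ J ^ t)) ⟨t, quotientHom_torsion _ z⟩
      (ConcreteCategory.congr_hom hz (1 : R ⧸ J ^ t))
    have ht := fun f hf => ht' f (Ideal.pow_le_pow_right (le_max_right t t') hf)
    refine ⟨⟨max t t', le_max_left _ _⟩, quotientHomOfTorsion _ u ht, quotientHom_ext _ ?_⟩
    refine (congrArg _ (quotientHomOfTorsion_one _ u ht)).trans (hu.trans ?_)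
    rfl

end Criterion

section Resolution

open CategoryTheory Limits Opposite

variable {R : Type} [CommRing R] {M : ModuleCat.{0} R} (E : InjectiveResolution M)

theorem injectiveResolution_injective (n : ℕ) : Module.Injective R (E.cocomplex.X n) :=
  haveI : CategoryTheory.Injective (ModuleCat.of R (E.cocomplex.X n)) := E.injective n
  Module.injective_module_of_injective_object R (E.cocomplex.X n)

theorem injectiveResolution_d_comp_d (n : ℕ) (x : E.cocomplex.X n) :
    E.cocomplex.d (n + 1) (n + 2) (E.cocomplex.d n (n + 1) x) = 0 := by
  rw [← ModuleCat.comp_apply, HomologicalComplex.d_comp_d]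
  rfl

theorem injectiveResolution_exact (n : ℕ) (x : E.cocomplex.X (n + 1))
    (hx : E.cocomplex.d (n + 1) (n + 2) x = 0) : ∃ y, E.cocomplex.d n (n + 1) y = x :=
  (ShortComplex.moduleCat_exact_iff _).1 (E.exact_succ n) x hx

theorem injectiveResolution_exact_zero (x : E.cocomplex.X 0)
    (hx : E.cocomplex.d 0 1 x = 0) : ∃ y : M, E.ι.f 0 y = x :=
  (ShortComplex.moduleCat_exact_iff _).1 E.exact₀ x hx

theorem injectiveResolution_d_ι (x : M) : E.cocomplex.d 0 1 (E.ι.f 0 x) = 0 :=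
  ConcreteCategory.congr_hom E.ι_f_zero_comp_complex_d x

theorem injectiveResolution_ι_injective : Function.Injective (fun x : M => E.ι.f 0 x) :=
  (ModuleCat.mono_iff_injective (E.ι.f 0)).1 inferInstance
end Resolution

section Torsion

variable {R : Type} [CommRing R] {J : Ideal R} {N N' : Type*} [AddCommGroup N] [Module R N]
  [AddCommGroup N'] [Module R N']

theorem IsPowTorsion.zero : IsPowTorsion J (0 : N) :=
  ⟨0, fun f _ => smul_zero f⟩

theorem IsPowTorsion.add {x y : N} (hx : IsPowTorsion J x) (hy : IsPowTorsion J y) :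
    IsPowTorsion J (x + y) := by
  obtain ⟨s, hs⟩ := hx
  obtain ⟨t, ht⟩ := hy
  refine ⟨max s t, fun f hf => ?_⟩
  rw [smul_add, hs f (Ideal.pow_le_pow_right (le_max_left s t) hf),
    ht f (Ideal.pow_le_pow_right (le_max_right s t) hf), add_zero]

theorem IsPowTorsion.map {x : N} (hx : IsPowTorsion J x) (g : N →ₗ[R] N') :
    IsPowTorsion J (g x) := by
  obtain ⟨s, hs⟩ := hx
  exact ⟨s, fun f hf => by rw [← map_smul, hs f hf, map_zero]⟩

theorem IsPowTorsion.smul {x : N} (hx : IsPowTorsion J x) (c : R) : IsPowTorsion J (c • x) :=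
  hx.map (LinearMap.lsmul R N c)

theorem IsPowTorsion.neg {x : N} (hx : IsPowTorsion J x) : IsPowTorsion J (-x) :=
  hx.map (-LinearMap.id)

theorem IsPowTorsion.sub {x y : N} (hx : IsPowTorsion J x) (hy : IsPowTorsion J y) :
    IsPowTorsion J (x - y) := by
  rw [sub_eq_add_neg]
  exact hx.add hy.neg

theorem IsPowTorsion.mono {J' : Ideal R} (h : J ≤ J') {x : N} (hx : IsPowTorsion J' x) :
    IsPowTorsion J x := by
  obtain ⟨s, hs⟩ := hx
  exact ⟨s, fun f hf => hs f (Ideal.pow_right_mono h s hf)⟩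

theorem IsPowTorsion.exists_pow_smul {x : N} (hx : IsPowTorsion J x) {f : R} (hf : f ∈ J) :
    ∃ n : ℕ, f ^ n • x = 0 := by
  obtain ⟨s, hs⟩ := hx
  exact ⟨s, hs _ (Ideal.pow_mem_pow hf s)⟩

theorem IsPowTorsion.sup_span {x : N} (hx : IsPowTorsion J x) {f : R} {n : ℕ}
    (hf : f ^ n • x = 0) : IsPowTorsion (J ⊔ Ideal.span {f}) x := by
  obtain ⟨s, hs⟩ := hx
  refine ⟨s + n, fun g hg => ?_⟩
  obtain ⟨a, ha, b, hb, rfl⟩ := Submodule.mem_sup.1 (Ideal.sup_pow_add_le_pow_sup_pow hg)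
  rw [Ideal.span_singleton_pow, Ideal.mem_span_singleton] at hb
  obtain ⟨c, rfl⟩ := hb
  rw [add_smul, hs a ha, mul_comm, mul_smul, hf, smul_zero, add_zero]

theorem isPowTorsion_bot (x : N) : IsPowTorsion (⊥ : Ideal R) x :=
  ⟨1, fun f hf => by
    rw [pow_one, Ideal.mem_bot] at hf
    rw [hf, zero_smul]⟩

/-- Torsion elements of an injective module are divisible by powers of `f` up to elements killed
by a power of `f`. -/
theorem IsPowTorsion.exists_divide [IsNoetherianRing R] {E : Type} [AddCommGroup E] [Module R E]
    (hE : Module.Injective R E) {v : E} (hv : IsPowTorsion J v) (f : R) (n : ℕ) :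
    ∃ v' : E, IsPowTorsion J v' ∧ ∃ m : ℕ, f ^ (n + m) • v' = f ^ m • v := by
  obtain ⟨t, ht⟩ := hv
  let ψ : ℕ → (R →ₗ[R] R ⧸ J ^ t) := fun k => (J ^ t).mkQ ∘ₗ LinearMap.lsmul R R (f ^ k)
  have hψ : ∀ k x, ψ k x = 0 ↔ f ^ k * x ∈ J ^ t := fun k x => Submodule.Quotient.mk_eq_zero _
  let K : ℕ →o Ideal R := ⟨fun k => LinearMap.ker (ψ k), monotone_nat_of_le_succ fun k x hx => by
    rw [LinearMap.mem_ker, hψ] at hx ⊢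
    rw [pow_succ', mul_assoc]
    exact Ideal.mul_mem_left _ _ hx⟩
  obtain ⟨m, hm⟩ := monotone_stabilizes_iff_noetherian.2 (inferInstance : IsNoetherian R R) K
  have hker : LinearMap.ker (ψ (n + m)) = LinearMap.ker (ψ m) := (hm (n + m) (by omega)).symm
  let g : R →ₗ[R] E := LinearMap.toSpanSingleton R E (f ^ m • v)
  have hg : LinearMap.ker (ψ (n + m)) ≤ LinearMap.ker g := by
    intro x hx
    rw [hker, LinearMap.mem_ker, hψ] at hx
    rw [LinearMap.mem_ker, LinearMap.toSpanSingleton_apply, ← mul_smul, mul_comm]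
    exact ht _ hx
  obtain ⟨h, hh⟩ := hE.out ((LinearMap.ker (ψ (n + m))).liftQ (ψ (n + m)) le_rfl)
    (LinearMap.ker_eq_bot.1 (Submodule.ker_liftQ_eq_bot _ _ _ le_rfl))
    ((LinearMap.ker (ψ (n + m))).liftQ g hg)
  refine ⟨h ((J ^ t).mkQ 1), ⟨t, fun a ha => ?_⟩, m, ?_⟩
  · rw [← map_smul, ← map_smul]
    have : (J ^ t).mkQ (a • (1 : R)) = 0 := by simpa using Ideal.Quotient.eq_zero_iff_mem.2 ha
    rw [this, map_zero]
  · have h1 := hh (Submodule.Quotient.mk (1 : R))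
    rw [Submodule.liftQ_apply, Submodule.liftQ_apply, LinearMap.toSpanSingleton_apply,
      one_smul] at h1
    rw [← h1, ← map_smul]
    rfl

end Torsion

section Zigzag

variable {R : Type} [CommRing R]

theorem pow_smul_eq_of_pow_smul_eq {N : Type*} [AddCommGroup N] [Module R N] {f : R} {v w : N}
    {a b a' b' : ℕ} (h : f ^ a • v = f ^ b • w) (c : ℕ) (ha : a' = c + a) (hb : b' = c + b) :
    f ^ a' • v = f ^ b' • w := by
  rw [ha, hb, pow_add, pow_add, mul_smul, mul_smul, h]

/-- The ideal generated by the first `j` elements of a sequence. -/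
def initialIdeal (f : ℕ → R) : ℕ → Ideal R
  | 0 => ⊥
  | j + 1 => initialIdeal f j ⊔ Ideal.span {f j}

theorem initialIdeal_mono (f : ℕ → R) (j : ℕ) : initialIdeal f j ≤ initialIdeal f (j + 1) :=
  le_sup_left

theorem initialIdeal_self_mem (f : ℕ → R) (j : ℕ) : f j ∈ initialIdeal f (j + 1) :=
  Ideal.mem_sup_right (Ideal.mem_span_singleton_self _)

theorem initialIdeal_eq_span (f : ℕ → R) (j : ℕ) :
    initialIdeal f j = Ideal.span (f '' Set.Iio j) := by
  induction j with
  | zero => simp [initialIdeal]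
  | succ j ih =>
    rw [initialIdeal, ih, ← Ideal.span_union, ← Set.image_singleton, ← Set.image_union]
    congr 2
    ext i
    simp only [Set.mem_union, Set.mem_Iio, Set.mem_singleton_iff]
    omega

theorem prod_pow_mul_mem_initialIdeal (f : ℕ → R) (p A : ℕ) (j : ℕ) {x : R}
    (hx : x ∈ initialIdeal (fun i => f i ^ p) j) :
    (∏ i ∈ Finset.range j, f i) ^ A * x ∈ initialIdeal (fun i => f i ^ (p + A)) j := by
  induction j generalizing x with
  | zero =>
    simp only [initialIdeal, Ideal.mem_bot] at hx ⊢
    rw [hx, mul_zero]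
  | succ j ih =>
    obtain ⟨a, ha, b, hb, rfl⟩ := Submodule.mem_sup.1 hx
    obtain ⟨c, rfl⟩ := Ideal.mem_span_singleton.1 hb
    rw [Finset.prod_range_succ, mul_pow, mul_add]
    refine Ideal.add_mem _ (Ideal.mem_sup_left ?_) (Ideal.mem_sup_right ?_)
    · rw [mul_comm (_ ^ A) (f j ^ A), mul_assoc]
      exact Ideal.mul_mem_left _ _ (ih ha)
    · refine Ideal.mem_span_singleton.2 ⟨(∏ i ∈ Finset.range j, f i) ^ A * c, ?_⟩
      ring

variable {E : ℕ → Type} [∀ i, AddCommGroup (E i)] [∀ i, Module R (E i)]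
  (d : ∀ i, E i →ₗ[R] E (i + 1))

theorem exists_torsion_preimage [IsNoetherianRing R] (hinj : ∀ i, Module.Injective R (E i))
    (hdd : ∀ i x, d (i + 1) (d i x) = 0)
    (hex : ∀ i x, d (i + 1) x = 0 → ∃ y, d i y = x) (f : ℕ → R) (j : ℕ) :
    ∀ i, j ≤ i → ∀ z : E (i + 1), IsPowTorsion (initialIdeal f j) z → d (i + 1) z = 0 →
      ∃ u, IsPowTorsion (initialIdeal f j) u ∧ d i u = z := by
  induction j with
  | zero =>
    intro i _ z _ hz
    obtain ⟨y, hy⟩ := hex i z hz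
    exact ⟨y, isPowTorsion_bot y, hy⟩
  | succ j ih =>
    intro i hi z hzt hz
    obtain ⟨i, rfl⟩ : ∃ i', i = i' + 1 := ⟨i - 1, by omega⟩
    obtain ⟨w, hwt, hw⟩ := ih (i + 1) (by omega) z (hzt.mono (initialIdeal_mono f j)) hz
    obtain ⟨n, hn⟩ := hzt.exists_pow_smul (initialIdeal_self_mem f j)
    obtain ⟨v, hvt, hv⟩ := ih i (by omega) (f j ^ n • w) (hwt.smul _) (by
      rw [map_smul, hw, hn])
    obtain ⟨v', hvt', m, hm⟩ := hvt.exists_divide (hinj i) (f j) n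
    refine ⟨w - d i v', (hwt.sub (hvt'.map _)).sup_span (n := n + m) ?_, ?_⟩
    · rw [smul_sub, ← map_smul, hm, map_smul, hv, ← mul_smul, ← pow_add, Nat.add_comm m n, sub_self]
    · rw [map_sub, hdd, sub_zero, hw]

/-- The cocycle `z` represents the class of the fraction `a / (f₀ ⋯ f_{j-1})^n` in the `j`-th
local cohomology. -/
def FractionClass (ι : R →ₗ[R] E 0) (f : ℕ → R) (n : ℕ) : ∀ j : ℕ, R → E j → Prop
  | 0, a, z => z = ι a
  | j + 1, a, z => ∃ w, FractionClass ι f n j a w ∧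
      ∃ v, IsPowTorsion (initialIdeal f j) v ∧ ∃ m : ℕ, f j ^ (n + m) • v = f j ^ m • w ∧
      ∃ b, IsPowTorsion (initialIdeal f (j + 1)) b ∧ z = d j v + d j b

variable {d} {ι : R →ₗ[R] E 0} {f : ℕ → R}

theorem FractionClass.d_eq_zero (hdι : ∀ a, d 0 (ι a) = 0) (hdd : ∀ i x, d (i + 1) (d i x) = 0)
    {n : ℕ} : ∀ {j : ℕ} {a : R} {z : E j}, FractionClass d ι f n j a z → d j z = 0
  | 0, a, z, h => by rw [h, hdι]
  | j + 1, a, z, h => by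
    obtain ⟨w, -, v, -, m, -, b, -, rfl⟩ := h
    rw [map_add, hdd, hdd, add_zero]

theorem FractionClass.isPowTorsion (hdι : ∀ a, d 0 (ι a) = 0)
    (hdd : ∀ i x, d (i + 1) (d i x) = 0) {n : ℕ} :
    ∀ {j : ℕ} {a : R} {z : E j}, FractionClass d ι f n j a z → IsPowTorsion (initialIdeal f j) z
  | 0, a, z, _ => isPowTorsion_bot z
  | j + 1, a, z, h => by
    obtain ⟨w, hw, v, hv, m, hm, b, hb, rfl⟩ := h
    refine ((hv.map _).sup_span (n := n + m) ?_).add (hb.map _)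
    rw [← map_smul, hm, map_smul, hw.d_eq_zero hdι hdd, smul_zero]

theorem FractionClass.add {n : ℕ} : ∀ {j : ℕ} {a a' : R} {z z' : E j},
    FractionClass d ι f n j a z → FractionClass d ι f n j a' z' →
      FractionClass d ι f n j (a + a') (z + z')
  | 0, a, a', z, z', h, h' => by
    rw [FractionClass] at *
    rw [h, h', map_add]
  | j + 1, a, a', z, z', h, h' => by
    obtain ⟨w, hw, v, hv, m, hm, b, hb, rfl⟩ := h
    obtain ⟨w', hw', v', hv', m', hm', b', hb', rfl⟩ := h'
    refine ⟨w + w', hw.add hw', v + v', hv.add hv', m + m', ?_, b + b', hb.add hb', ?_⟩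
    · rw [smul_add, smul_add, pow_smul_eq_of_pow_smul_eq hm m' (by ring) (Nat.add_comm m m'),
        pow_smul_eq_of_pow_smul_eq hm' m (by ring) rfl]
    · rw [map_add, map_add]
      abel

theorem FractionClass.smul {n : ℕ} (c : R) : ∀ {j : ℕ} {a : R} {z : E j},
    FractionClass d ι f n j a z → FractionClass d ι f n j (c * a) (c • z)
  | 0, a, z, h => by
    rw [FractionClass] at *
    rw [h, ← smul_eq_mul, map_smul]
  | j + 1, a, z, h => by
    obtain ⟨w, hw, v, hv, m, hm, b, hb, rfl⟩ := h
    refine ⟨c • w, hw.smul c, c • v, hv.smul c, m, ?_, c • b, hb.smul c, ?_⟩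
    · rw [smul_comm, hm, smul_comm]
    · rw [smul_add, map_smul, map_smul]

theorem FractionClass.add_exponent {n : ℕ} (N : ℕ) : ∀ {j : ℕ} {a : R} {z : E j},
    FractionClass d ι f n j a z →
      FractionClass d ι f (n + N) j ((∏ i ∈ Finset.range j, f i) ^ N * a) z
  | 0, a, z, h => by
    rw [FractionClass] at *
    simp [h]
  | j + 1, a, z, h => by
    obtain ⟨w, hw, v, hv, m, hm, b, hb, rfl⟩ := h
    refine ⟨f j ^ N • w, ?_, v, hv, m, ?_, b, hb, rfl⟩
    · have := (hw.add_exponent N).smul (f j ^ N)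
      rwa [← mul_assoc, ← mul_pow, mul_comm (f j), ← Finset.prod_range_succ] at this
    · rw [show n + N + m = N + (n + m) by ring, pow_add, mul_smul, hm, smul_comm]

theorem FractionClass.exists_cocycle [IsNoetherianRing R]
    (hinj : ∀ i, Module.Injective R (E i)) (hdι : ∀ a, d 0 (ι a) = 0)
    (hdd : ∀ i x, d (i + 1) (d i x) = 0) (n : ℕ) :
    ∀ (j : ℕ) (a : R), ∃ z : E j, FractionClass d ι f n j a z
  | 0, a => ⟨ι a, rfl⟩
  | j + 1, a => by
    obtain ⟨w, hw⟩ := exists_cocycle hinj hdι hdd n j a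
    obtain ⟨v, hv, m, hm⟩ := (hw.isPowTorsion hdι hdd).exists_divide (hinj j) (f j) n
    exact ⟨d j v + d j 0, w, hw, v, hv, m, hm, 0, IsPowTorsion.zero, rfl⟩

theorem FractionClass.exists_fraction [IsNoetherianRing R]
    (hinj : ∀ i, Module.Injective R (E i)) (hdd : ∀ i x, d (i + 1) (d i x) = 0)
    (hex : ∀ i x, d (i + 1) x = 0 → ∃ y, d i y = x)
    (hex0 : ∀ x, d 0 x = 0 → ∃ a, ι a = x) :
    ∀ (j : ℕ) (z : E j), IsPowTorsion (initialIdeal f j) z → d j z = 0 →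
      ∃ n a, FractionClass d ι f n j a z
  | 0, z, _, hz => by
    obtain ⟨a, rfl⟩ := hex0 z hz
    exact ⟨0, a, rfl⟩
  | j + 1, z, hzt, hz => by
    obtain ⟨v, hvt, rfl⟩ := exists_torsion_preimage d hinj hdd hex f j j le_rfl z
      (hzt.mono (initialIdeal_mono f j)) hz
    obtain ⟨p, hp⟩ := hzt.exists_pow_smul (initialIdeal_self_mem f j)
    obtain ⟨n, a, ha⟩ := exists_fraction hinj hdd hex hex0 j (f j ^ p • v) (hvt.smul _)
      (by rw [map_smul, hp])
    refine ⟨n + p, _, f j ^ n • f j ^ p • v, (ha.add_exponent p).smul (f j ^ n), v, hvt, 0, ?_, 0,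
      IsPowTorsion.zero, by rw [map_zero, add_zero]⟩
    rw [pow_zero, one_smul, add_zero, pow_add, mul_smul]

theorem FractionClass.eq_zero [IsNoetherianRing R]
    (hinj : ∀ i, Module.Injective R (E i)) (hdι : ∀ a, d 0 (ι a) = 0)
    (hdd : ∀ i x, d (i + 1) (d i x) = 0)
    (hex : ∀ i x, d (i + 1) x = 0 → ∃ y, d i y = x)
    (hex0 : ∀ x, d 0 x = 0 → ∃ a, ι a = x) (hι : Function.Injective ι) :
    ∀ (j : ℕ) (n : ℕ) (a : R), FractionClass d ι f n j a (0 : E j) →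
      ∃ N, (∏ i ∈ Finset.range j, f i) ^ N * a ∈ initialIdeal (fun i => f i ^ (n + N)) j
  | 0, n, a, h => by
    have : a = 0 := hι (by rw [map_zero, ← show (0 : E 0) = ι a from h])
    exact ⟨0, by simp [this]⟩
  | j + 1, n, a, h => by
    obtain ⟨w, hw, v, hv, m, hm, b, hb, hz⟩ := h
    obtain ⟨K, hK⟩ := hb.exists_pow_smul (initialIdeal_self_mem f j)
    have hu : IsPowTorsion (initialIdeal f j) (v + b) := hv.add (hb.mono (initialIdeal_mono f j))
    obtain ⟨p, c, hc⟩ := exists_fraction hinj hdd hex hex0 j (v + b) hu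
      (by rw [map_add, ← hz])
    have key : f j ^ (m + K) • w - f j ^ (n + m + K) • (v + b) = 0 := by
      have h1 : f j ^ (n + m + K) • b = 0 := by rw [pow_add, mul_smul, hK, smul_zero]
      rw [smul_add, h1, add_zero, pow_smul_eq_of_pow_smul_eq hm K (by ring) (Nat.add_comm m K),
        sub_self]
    have h1 := (hw.smul (f j ^ (m + K))).add_exponent p
    have h2 := ((hc.smul (f j ^ (n + m + K))).add_exponent n).smul (-1)
    rw [add_comm p n] at h2
    have h3 := h1.add h2
    rw [neg_one_smul, ← sub_eq_add_neg, key] at h3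
    obtain ⟨N, hN⟩ := eq_zero hinj hdι hdd hex hex0 hι j (n + p) _ h3
    refine ⟨N + p + m + K, ?_⟩
    have h4 := prod_pow_mul_mem_initialIdeal f _ (m + K) j hN
    rw [show n + p + N + (m + K) = n + (N + p + m + K) by ring] at h4
    have h5 : f j ^ (n + (N + p + m + K)) ∈
        Ideal.span {(fun i => f i ^ (n + (N + p + m + K))) j} :=
      Ideal.mem_span_singleton_self _
    have h6 := Ideal.add_mem _ (Ideal.mem_sup_left (Ideal.mul_mem_left _ (f j ^ (N + p)) h4))
      (Ideal.mem_sup_right (Ideal.mul_mem_left _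
        ((∏ i ∈ Finset.range j, f i) ^ (N + n + m + K) * c) h5))
    refine (congrArg (· ∈ initialIdeal (fun i => f i ^ (n + (N + p + m + K))) (j + 1)) ?_).mpr h6
    rw [Finset.prod_range_succ]
    ring

theorem exists_prod_pow_mem_initialIdeal [IsNoetherianRing R]
    (hinj : ∀ i, Module.Injective R (E i)) (hdι : ∀ a, d 0 (ι a) = 0)
    (hdd : ∀ i x, d (i + 1) (d i x) = 0)
    (hex : ∀ i x, d (i + 1) x = 0 → ∃ y, d i y = x)
    (hex0 : ∀ x, d 0 x = 0 → ∃ a, ι a = x) (hι : Function.Injective ι) (j : ℕ)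
    (h : ∀ z : E (j + 1), IsPowTorsion (initialIdeal f (j + 1)) z → d (j + 1) z = 0 →
      ∃ u, IsPowTorsion (initialIdeal f (j + 1)) u ∧ d j u = z) :
    ∃ N : ℕ, (∏ i ∈ Finset.range (j + 1), f i) ^ N ∈
      initialIdeal (fun i => f i ^ (N + 1)) (j + 1) := by
  obtain ⟨z, hz⟩ := FractionClass.exists_cocycle (f := f) hinj hdι hdd 1 (j + 1) 1
  obtain ⟨u, hut, hu⟩ := h z (hz.isPowTorsion hdι hdd) (hz.d_eq_zero hdι hdd)
  have h0 : FractionClass d ι f 1 (j + 1) 1 (0 : E (j + 1)) := by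
    obtain ⟨w, hw, v, hv, m, hm, b, hb, hzb⟩ := hz
    refine ⟨w, hw, v, hv, m, hm, b - u, hb.sub hut, ?_⟩
    rw [map_sub, hu, hzb]
    abel
  obtain ⟨N, hN⟩ := FractionClass.eq_zero hinj hdι hdd hex hex0 hι _ _ _ h0
  rw [mul_one, add_comm 1 N] at hN
  exact ⟨N, hN⟩

end Zigzag

section Bounds

open CategoryTheory Limits Opposite

variable {R : Type} [CommRing R] [IsNoetherianRing R] (f : ℕ → R)

theorem subsingleton_localCohomology_initialIdeal (j i : ℕ) (hij : j < i) (M : ModuleCat.{0} R) :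
    Subsingleton ((localCohomology (initialIdeal f j) i).obj M) := by
  obtain ⟨i, rfl⟩ : ∃ i', i = i' + 1 := ⟨i - 1, by omega⟩
  let E := injectiveResolution M
  rw [subsingleton_localCohomology_iff _ _ E]
  exact exists_torsion_preimage (fun i => (E.cocomplex.d i (i + 1)).hom)
    (injectiveResolution_injective E) (injectiveResolution_d_comp_d E)
    (injectiveResolution_exact E) f j i (by omega)

theorem exists_prod_pow_mem_of_subsingleton_localCohomology (j : ℕ)
    (h : Subsingleton ((localCohomology (initialIdeal f (j + 1)) (j + 1)).obj
      (ModuleCat.of R R))) :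
    ∃ N : ℕ, (∏ i ∈ Finset.range (j + 1), f i) ^ N ∈
      initialIdeal (fun i => f i ^ (N + 1)) (j + 1) := by
  let E := injectiveResolution (ModuleCat.of R R)
  rw [subsingleton_localCohomology_iff _ _ E] at h
  exact exists_prod_pow_mem_initialIdeal (d := fun i => (E.cocomplex.d i (i + 1)).hom)
    (ι := (E.ι.f 0).hom)
    (injectiveResolution_injective E) (injectiveResolution_d_ι E) (injectiveResolution_d_comp_d E)
    (injectiveResolution_exact E) (injectiveResolution_exact_zero E)
    (injectiveResolution_ι_injective E) j h

end Bounds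

section Minors

variable {r s : ℕ} {T : Type*} [CommRing T]

/-- The maximal minor of a matrix on the columns `c`. -/
def colMinor (A : Matrix (Fin r) (Fin s) T) (c : Fin r → Fin s) : T :=
  (A.submatrix id c).det

open Classical in
/-- The sum of the maximal minors on columns `c₁ < ⋯ < c_r` of rank `j`. -/
noncomputable def rankSum (A : Matrix (Fin r) (Fin s) T) (j : ℕ) : T :=
  ∑ c ∈ Finset.univ.filter fun c : Fin r → Fin s =>
    StrictMono c ∧ ∑ i, (c i : ℕ) = ∑ i : Fin r, (i : ℕ) + j, colMinor A c

theorem map_colMinor {T' : Type*} [CommRing T'] (g : T →+* T') (A : Matrix (Fin r) (Fin s) T)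
    (c : Fin r → Fin s) : g (colMinor A c) = colMinor (A.map g) c := by
  rw [colMinor, RingHom.map_det]
  rfl

theorem map_rankSum {T' : Type*} [CommRing T'] (g : T →+* T') (A : Matrix (Fin r) (Fin s) T)
    (j : ℕ) : g (rankSum A j) = rankSum (A.map g) j := by
  simp only [rankSum, map_sum, map_colMinor]

theorem colMinor_comp_perm (A : Matrix (Fin r) (Fin s) T) (c : Fin r → Fin s)
    (σ : Equiv.Perm (Fin r)) : colMinor A (c ∘ σ) = Equiv.Perm.sign σ * colMinor A c :=
  Matrix.det_permute' σ (A.submatrix id c)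

theorem colMinor_mul (g : Matrix (Fin r) (Fin r) T) (A : Matrix (Fin r) (Fin s) T)
    (c : Fin r → Fin s) : colMinor (g * A) c = g.det * colMinor A c := by
  rw [colMinor, colMinor, ← Matrix.det_mul, ← Matrix.submatrix_mul_equiv g A id (Equiv.refl _) c]
  rfl

theorem rankSum_mul (g : Matrix (Fin r) (Fin r) T) (A : Matrix (Fin r) (Fin s) T)
    (j : ℕ) : rankSum (g * A) j = g.det * rankSum A j := by
  simp only [rankSum, colMinor_mul, Finset.mul_sum]

theorem injective_of_colMinor_ne_zero {A : Matrix (Fin r) (Fin s) T} {c : Fin r → Fin s}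
    (h : colMinor A c ≠ 0) : Function.Injective c := by
  intro i j hij
  by_contra hne
  exact h (Matrix.det_zero_of_column_eq hne fun k => by simp [hij])

/-- Basis exchange for nonvanishing maximal minors. -/
theorem exists_colMinor_update_ne_zero {K : Type*} [Field K] {A : Matrix (Fin r) (Fin s) K}
    {a b : Fin r → Fin s} (ha : colMinor A a ≠ 0) (hb : colMinor A b ≠ 0) (i : Fin r)
    (hi : a i ∉ Set.range b) :
    ∃ j, b j ∉ Set.range a ∧ colMinor A (Function.update b j (a i)) ≠ 0 := by
  by_contra! H
  have hla : LinearIndependent K (A.submatrix id a).col :=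
    Matrix.linearIndependent_cols_of_isUnit
      ((Matrix.isUnit_iff_isUnit_det _).2 (isUnit_iff_ne_zero.2 ha))
  set M := A.submatrix id b with hM
  let x : Fin r → K := fun k => A k (a i)
  have hcr : M.mulVec (M.cramer x) = M.det • x := Matrix.mulVec_cramer M x
  have hentry : ∀ j, M.cramer x j = colMinor A (Function.update b j (a i)) := by
    intro j
    rw [Matrix.cramer_apply, colMinor]
    congr 1
    ext k l
    by_cases hl : l = j
    · subst hl
      simp [x]
    · simp [hM, Matrix.updateCol_ne hl, Function.update_of_ne hl]
  have hmem : x ∈ Submodule.span K ((A.submatrix id a).col '' (Set.univ \ {i})) := by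
    have hx : x = (M.det)⁻¹ • M.mulVec (M.cramer x) := by
      rw [hcr, smul_smul, inv_mul_cancel₀ (show M.det ≠ 0 from hb), one_smul]
    rw [hx, Matrix.mulVec_eq_sum]
    refine Submodule.smul_mem _ _ (Submodule.sum_mem _ fun j _ => ?_)
    rw [op_smul_eq_smul]
    by_cases hj : b j ∈ Set.range a
    · obtain ⟨l, hl⟩ := hj
      apply Submodule.smul_mem
      apply Submodule.subset_span
      refine ⟨l, ⟨Set.mem_univ _, ?_⟩, ?_⟩
      · rintro rfl
        exact hi ⟨j, hl.symm⟩
      · funext k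
        simp [hM, hl, Matrix.col, Matrix.transpose]
    · rw [hentry, H j hj]
      simp
  exact hla.notMem_span_image (s := Set.univ \ {i}) (x := i) (by simp) hmem

theorem sum_update_lt {a b : Fin r → Fin s} {i j : Fin r} (h : a i < b j) :
    ∑ k, (Function.update b j (a i) k : ℕ) < ∑ k, (b k : ℕ) := by
  refine Finset.sum_lt_sum (fun k _ => ?_) ⟨j, Finset.mem_univ _, by simpa using h⟩
  by_cases hk : k = j
  · subst hk
    simpa using h.le
  · simp [Function.update_of_ne hk]

theorem range_eq_of_colMinor_ne_zero {K : Type*} [Field K] {A : Matrix (Fin r) (Fin s) K} {N : ℕ}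
    (H : ∀ c : Fin r → Fin s, ∑ i, (c i : ℕ) < N → colMinor A c = 0)
    {a b : Fin r → Fin s} (ha : colMinor A a ≠ 0) (hb : colMinor A b ≠ 0)
    (hNa : ∑ i, (a i : ℕ) = N) (hNb : ∑ i, (b i : ℕ) = N) : Set.range a = Set.range b := by
  by_contra hne
  have hnonempty : (symmDiff (Set.range a) (Set.range b)).Nonempty := by
    rw [Set.nonempty_iff_ne_empty]
    intro h
    exact hne (symmDiff_eq_bot.1 h)
  obtain ⟨x, hx, hmin⟩ := Set.exists_min_image _ id (Set.toFinite _) hnonempty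
  rcases hx with ⟨⟨i, rfl⟩, hi⟩ | ⟨⟨i, rfl⟩, hi⟩
  · obtain ⟨j, hj, hj'⟩ := exists_colMinor_update_ne_zero ha hb i hi
    have hle : a i ≤ b j := hmin (b j) (Or.inr ⟨⟨j, rfl⟩, hj⟩)
    have hlt := lt_of_le_of_ne hle fun h => hi ⟨j, h.symm⟩
    exact hj' (H _ (hNb ▸ sum_update_lt hlt))
  · obtain ⟨j, hj, hj'⟩ := exists_colMinor_update_ne_zero hb ha i hi
    have hle : b i ≤ a j := hmin (a j) (Or.inl ⟨⟨j, rfl⟩, hj⟩)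
    have hlt := lt_of_le_of_ne hle fun h => hi ⟨j, h.symm⟩
    exact hj' (H _ (hNa ▸ sum_update_lt hlt))

theorem exists_perm_strictMono {c : Fin r → Fin s} (hc : Function.Injective c) :
    ∃ σ : Equiv.Perm (Fin r), StrictMono (c ∘ σ) :=
  ⟨Tuple.sort c, (Tuple.monotone_sort c).strictMono_of_injective
    (hc.comp (Tuple.sort c).injective)⟩

theorem StrictMono.exists_rank {c : Fin r → Fin s} (hc : StrictMono c) :
    ∃ j ≤ r * (s - r), ∑ i, (c i : ℕ) = ∑ i : Fin r, (i : ℕ) + j := by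
  have h1 : ∀ i : Fin r, (i : ℕ) ≤ c i := by
    rintro ⟨i, hi⟩
    induction i with
    | zero => simp
    | succ i ih =>
      have := ih (by omega)
      have h2 : c ⟨i, by omega⟩ < c ⟨i + 1, hi⟩ := hc (by simp)
      have h3 : (c ⟨i, by omega⟩ : ℕ) < c ⟨i + 1, hi⟩ := h2
      simp only at this ⊢
      omega
  have h2 : ∀ n, ∀ i : Fin r, r = i + 1 + n → (c i : ℕ) + 1 + n ≤ s := by
    intro n
    induction n with
    | zero => intro i _; have := (c i).2; omega
    | succ n ih =>
      intro i hi
      have h2 : c i < c ⟨i + 1, by omega⟩ := hc (by simp [Fin.lt_def])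
      have h3 : (c i : ℕ) < c ⟨i + 1, by omega⟩ := h2
      have := ih ⟨i + 1, by omega⟩ (by simp only; omega)
      omega
  refine ⟨∑ i, ((c i : ℕ) - i), ?_, ?_⟩
  · calc ∑ i, ((c i : ℕ) - i) ≤ ∑ i : Fin r, (s - r) := Finset.sum_le_sum fun i _ => by
          have := h2 (r - (i + 1)) i (by omega)
          omega
      _ = r * (s - r) := by simp
  · rw [← Finset.sum_add_distrib]
    exact Finset.sum_congr rfl fun i _ => by have := h1 i; omega

theorem colMinor_eq_zero_of_rankSum_eq_zero {K : Type*} [Field K] (A : Matrix (Fin r) (Fin s) K)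
    (H : ∀ j ≤ r * (s - r), rankSum A j = 0) (c : Fin r → Fin s) : colMinor A c = 0 := by
  classical
  obtain ⟨N, hN⟩ : ∃ N, ∑ i, (c i : ℕ) = N := ⟨_, rfl⟩
  induction N using Nat.strong_induction_on generalizing c with
  | _ N ih =>
    by_contra hc
    obtain ⟨σ, hσ⟩ := exists_perm_strictMono (injective_of_colMinor_ne_zero hc)
    have ha : colMinor A (c ∘ σ) ≠ 0 := by
      rw [colMinor_comp_perm]
      rcases Int.units_eq_one_or (Equiv.Perm.sign σ) with h | h <;> simp [h, hc]
    have hNa : ∑ i, ((c ∘ σ) i : ℕ) = N := by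
      rw [← hN]
      exact Equiv.sum_comp σ fun i => (c i : ℕ)
    obtain ⟨j, hj, hj'⟩ := hσ.exists_rank
    have hsum := H j hj
    rw [rankSum, Finset.sum_eq_single_of_mem (c ∘ σ) (by simpa using ⟨hσ, hj'⟩)] at hsum
    · exact ha hsum
    · intro b hb hne
      by_contra hb0
      rw [Finset.mem_filter] at hb
      refine hne ((hb.2.1.range_inj hσ).1 ?_)
      exact range_eq_of_colMinor_ne_zero (N := N) (fun c hc => ih _ hc c rfl) hb0 ha
        (by rw [hb.2.2, ← hj', hNa]) hNa

theorem minorsIdeal_radical_eq {T : Type} [CommRing T] (A : Matrix (Fin r) (Fin s) T) :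
    (minorsIdeal A r).radical = (initialIdeal (rankSum A) (r * (s - r) + 1)).radical := by
  classical
  apply le_antisymm
  · rw [Ideal.radical_le_radical_iff, minorsIdeal, Ideal.span_le]
    rintro _ ⟨⟨p, q⟩, rfl⟩
    rw [Ideal.radical_eq_sInf, SetLike.mem_coe, Ideal.mem_sInf]
    rintro P ⟨hP, hPp⟩
    let g : T →+* FractionRing (T ⧸ P) := (algebraMap (T ⧸ P) _).comp (Ideal.Quotient.mk P)
    have hg : ∀ x, g x = 0 ↔ x ∈ P := fun x => by
      rw [RingHom.comp_apply, IsFractionRing.to_map_eq_zero_iff, Ideal.Quotient.eq_zero_iff_mem]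
    let σ : Equiv.Perm (Fin r) := p.equivOfFiniteSelfEmbedding
    have h1 : (A.submatrix p q).det = Equiv.Perm.sign σ * colMinor A q :=
      Matrix.det_permute σ (A.submatrix id q)
    simp only [h1]
    refine Ideal.mul_mem_left _ _ ((hg _).1 ?_)
    rw [map_colMinor]
    refine colMinor_eq_zero_of_rankSum_eq_zero _ (fun j hj => ?_) _
    rw [← map_rankSum, hg]
    refine hP ?_
    rw [initialIdeal_eq_span]
    exact Ideal.subset_span ⟨j, by simpa [Nat.lt_succ_iff] using hj, rfl⟩
  · refine Ideal.radical_mono ?_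
    rw [initialIdeal_eq_span, Ideal.span_le]
    rintro _ ⟨j, -, rfl⟩
    refine Ideal.sum_mem _ fun c hc => Ideal.subset_span ?_
    rw [Finset.mem_filter] at hc
    exact ⟨⟨Function.Embedding.refl _, ⟨c, hc.2.1.injective⟩⟩, rfl⟩

end Minors

section FischerForm

open MvPolynomial

variable {σ : Type*}

/-- The Fischer inner product on rational polynomials, for which monomials are orthogonal and
`⟪x^m, x^m⟫ = m!`. -/
noncomputable def fischer : MvPolynomial σ ℚ →ₗ[ℚ] MvPolynomial σ ℚ →ₗ[ℚ] ℚ :=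
  (basisMonomials σ ℚ).constr ℚ fun m => (m.prod fun _ k => (k.factorial : ℚ)) • lcoeff ℚ m

theorem fischer_monomial (m : σ →₀ ℕ) (a : ℚ) (q : MvPolynomial σ ℚ) :
    fischer (monomial m a) q = a * ((m.prod fun _ k => (k.factorial : ℚ)) * coeff m q) := by
  have h : monomial m a = a • basisMonomials σ ℚ m := by
    rw [coe_basisMonomials, smul_monomial, smul_eq_mul, mul_one]
  rw [h, map_smul, fischer, Module.Basis.constr_basis]
  rfl

theorem fischer_self_pos {p : MvPolynomial σ ℚ} (hp : p ≠ 0) : 0 < fischer p p := by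
  have h : fischer p p = ∑ m ∈ p.support,
      coeff m p * ((m.prod fun _ k => (k.factorial : ℚ)) * coeff m p) := by
    conv_lhs => enter [1, 2]; rw [p.as_sum]
    rw [map_sum, LinearMap.sum_apply]
    exact Finset.sum_congr rfl fun m _ => fischer_monomial m _ p
  rw [h]
  refine Finset.sum_pos (fun m hm => ?_) (support_nonempty.2 hp)
  have h1 : 0 < m.prod fun _ k => (k.factorial : ℚ) :=
    Finset.prod_pos fun i _ => Nat.cast_pos.2 (Nat.factorial_pos _)
  have h2 : 0 < coeff m p * coeff m p := mul_self_pos.2 (mem_support_iff.1 hm)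
  calc 0 < (m.prod fun _ k => (k.factorial : ℚ)) * (coeff m p * coeff m p) := mul_pos h1 h2
    _ = _ := by ring

theorem fischer_self_eq_zero {p : MvPolynomial σ ℚ} (hp : fischer p p = 0) : p = 0 := by
  by_contra h
  exact (fischer_self_pos h).ne' hp

theorem fischer_X_mul (i : σ) (p q : MvPolynomial σ ℚ) :
    fischer (p * X i) q = fischer p (pderiv i q) := by
  induction p using MvPolynomial.induction_on' with
  | add p p' hp hp' =>
    rw [add_mul, map_add, map_add, LinearMap.add_apply, LinearMap.add_apply, hp, hp']
  | monomial m a =>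
    classical
    rw [X, monomial_mul, mul_one, fischer_monomial, fischer_monomial, coeff_pderiv]
    have : ((m + Finsupp.single i 1).prod fun _ k => (k.factorial : ℚ)) =
        (m.prod fun _ k => (k.factorial : ℚ)) * (m i + 1) := by
      rw [Finsupp.prod_of_support_subset (s := insert i m.support) _
        (by intro j hj; by_cases h : j = i <;> simp_all) _ (by simp),
        Finsupp.prod_of_support_subset (s := insert i m.support) m
        (by simp) _ (by simp),
        ← Finset.mul_prod_erase _ _ (Finset.mem_insert_self i _),
        ← Finset.mul_prod_erase (insert i m.support) (fun j => ((m j).factorial : ℚ))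
          (Finset.mem_insert_self i _)]
      have h : ∏ j ∈ (insert i m.support).erase i,
          (((m + Finsupp.single i 1 : σ →₀ ℕ) j).factorial : ℚ) =
          ∏ j ∈ (insert i m.support).erase i, ((m j).factorial : ℚ) :=
        Finset.prod_congr rfl fun j hj => by
          simp [(Finset.ne_of_mem_erase hj).symm]
      rw [h]
      simp [Nat.factorial_succ]
      ring
    rw [this]
    ring

theorem exists_fischer_adjoint (e q : MvPolynomial σ ℚ) :
    ∃ q', ∀ p, fischer (p * e) q = fischer p q' := by
  induction e using MvPolynomial.induction_on generalizing q with
  | C a =>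
    refine ⟨a • q, fun p => ?_⟩
    rw [mul_comm, ← smul_eq_C_mul, map_smul, map_smul]
    rfl
  | add e e' he he' =>
    obtain ⟨q₁, h₁⟩ := he q
    obtain ⟨q₂, h₂⟩ := he' q
    refine ⟨q₁ + q₂, fun p => ?_⟩
    rw [mul_add, map_add, map_add, LinearMap.add_apply, h₁, h₂]
  | mul_X e i he =>
    obtain ⟨q', h⟩ := he (pderiv i q)
    refine ⟨q', fun p => ?_⟩
    rw [← mul_assoc, fischer_X_mul, h]

theorem fischer_nondegenerate {q q' : MvPolynomial σ ℚ} (h : ∀ p, fischer p q = fischer p q') :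
    q = q' := by
  rw [← sub_eq_zero]
  apply fischer_self_eq_zero
  rw [map_sub, h, sub_self]

theorem exists_fischer_projection (A : Submodule ℚ (MvPolynomial σ ℚ)) [FiniteDimensional ℚ A]
    (p : MvPolynomial σ ℚ) : ∃ p' ∈ A, ∀ a ∈ A, fischer p' a = fischer p a := by
  let T : A →ₗ[ℚ] Module.Dual ℚ A := (LinearMap.lcomp ℚ ℚ A.subtype) ∘ₗ fischer ∘ₗ A.subtype
  have hT : ∀ x y : A, T x y = fischer (x : MvPolynomial σ ℚ) y := fun x y => rfl
  have hinj : Function.Injective T := by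
    rw [← LinearMap.ker_eq_bot, LinearMap.ker_eq_bot']
    intro x hx
    have := hT x x
    rw [hx] at this
    exact Subtype.ext (fischer_self_eq_zero this.symm)
  obtain ⟨x, hx⟩ := (LinearMap.injective_iff_surjective_of_finrank_eq_finrank
    Subspace.dual_finrank_eq.symm).1 hinj ((fischer p).comp A.subtype)
  refine ⟨x, x.2, fun a ha => ?_⟩
  rw [← hT x ⟨a, ha⟩, hx]
  rfl

end FischerForm

section SemiInvariants

open MvPolynomial

variable {r s : ℕ}

/-- The generic matrix. -/
noncomputable def genericMatrix (r s : ℕ) (K : Type*) [CommRing K] :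
    Matrix (Fin r) (Fin s) (MvPolynomial (Fin r × Fin s) K) :=
  Matrix.of fun i j => X (i, j)

/-- The action of a square matrix on polynomials by left multiplication on the generic matrix. -/
noncomputable def leftAct {K : Type*} [CommRing K] (g : Matrix (Fin r) (Fin r) K) :
    MvPolynomial (Fin r × Fin s) K →ₐ[K] MvPolynomial (Fin r × Fin s) K :=
  aeval fun ij => ∑ l, C (g ij.1 l) * X (l, ij.2)

theorem leftAct_X {K : Type*} [CommRing K] (g : Matrix (Fin r) (Fin r) K) (i : Fin r)
    (j : Fin s) : leftAct g (X (i, j)) = ∑ l, C (g i l) * X (l, j) := by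
  rw [leftAct, aeval_X]

theorem coeff_zero_leftAct {K : Type*} [CommRing K] (g : Matrix (Fin r) (Fin r) K)
    (q : MvPolynomial (Fin r × Fin s) K) : coeff 0 (leftAct g q) = coeff 0 q := by
  rw [← constantCoeff_eq, leftAct]
  change ((constantCoeff).comp (RingHomClass.toRingHom (aeval _))) q = _
  congr 1
  apply MvPolynomial.ringHom_ext
  · intro a; simp
  · rintro ⟨i, j⟩
    simp

theorem pderiv_leftAct {K : Type*} [CommRing K] (g : Matrix (Fin r) (Fin r) K) (i : Fin r)
    (j : Fin s) (q : MvPolynomial (Fin r × Fin s) K) :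
    pderiv (i, j) (leftAct g q) = ∑ l, C (g l i) * leftAct g (pderiv (l, j) q) := by
  induction q using MvPolynomial.induction_on with
  | C a => simp [leftAct]
  | add p q hp hq => simp only [map_add, hp, hq, mul_add, Finset.sum_add_distrib]
  | mul_X p ij hp =>
    obtain ⟨i', j'⟩ := ij
    have h : pderiv (i, j) (leftAct g (X (i', j') : MvPolynomial (Fin r × Fin s) K)) =
        ∑ l, C (g l i) *
          leftAct g (pderiv (l, j) (X (i', j') : MvPolynomial (Fin r × Fin s) K)) := by
      classical
      rw [leftAct_X, map_sum]
      by_cases hj : j' = j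
      · subst hj
        rw [Finset.sum_eq_single i, Finset.sum_eq_single i']
        · simp
        · intro b _ hb
          rw [pderiv_X_of_ne (by simpa using hb.symm), map_zero, mul_zero]
        · simp
        · intro b _ hb
          rw [pderiv_C_mul, pderiv_X_of_ne (by simpa using hb), mul_zero]
        · simp
      · rw [Finset.sum_eq_zero, Finset.sum_eq_zero]
        · intro b _
          rw [pderiv_X_of_ne (by simp [hj]), map_zero, mul_zero]
        · intro b _
          rw [pderiv_C_mul, pderiv_X_of_ne (by simp [hj]), mul_zero]
    rw [map_mul, pderiv_mul, hp, h, Finset.sum_mul, Finset.mul_sum, ← Finset.sum_add_distrib]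
    refine Finset.sum_congr rfl fun l _ => ?_
    rw [pderiv_mul, map_add, map_mul, map_mul]
    ring

theorem fischer_leftAct (g : Matrix (Fin r) (Fin r) ℚ) (p q : MvPolynomial (Fin r × Fin s) ℚ) :
    fischer (leftAct g p) q = fischer p (leftAct g.transpose q) := by
  induction p using MvPolynomial.induction_on generalizing q with
  | C a =>
    have : leftAct (s := s) g (C a) = C a := by simp [leftAct]
    rw [this, C_apply, fischer_monomial, fischer_monomial, coeff_zero_leftAct]
  | add p p' hp hp' =>
    rw [map_add, map_add, map_add, LinearMap.add_apply, LinearMap.add_apply, hp, hp']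
  | mul_X p ij hp =>
    obtain ⟨i, j⟩ := ij
    rw [fischer_X_mul, map_mul, leftAct_X, Finset.mul_sum, map_sum, LinearMap.sum_apply,
      pderiv_leftAct, map_sum]
    refine Finset.sum_congr rfl fun l _ => ?_
    rw [mul_left_comm, ← smul_eq_C_mul, ← smul_eq_C_mul, map_smul, map_smul, LinearMap.smul_apply,
      fischer_X_mul, hp]
    rfl

/-- The polynomials `p` with `p(gX) = det(g)^n p(X)` for all invertible rational `g`. -/
noncomputable def semiInvariants (r s n : ℕ) : Submodule ℚ (MvPolynomial (Fin r × Fin s) ℚ) where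
  carrier := {p | ∀ g : Matrix (Fin r) (Fin r) ℚ, g.det ≠ 0 → leftAct g p = g.det ^ n • p}
  zero_mem' g _ := by rw [map_zero, smul_zero]
  add_mem' hp hq g hg := by rw [map_add, hp g hg, hq g hg, smul_add]
  smul_mem' c p hp g hg := by rw [map_smul, hp g hg, smul_comm]

theorem mul_mem_semiInvariants {m n : ℕ} {p q : MvPolynomial (Fin r × Fin s) ℚ}
    (hp : p ∈ semiInvariants r s m) (hq : q ∈ semiInvariants r s n) :
    p * q ∈ semiInvariants r s (m + n) := fun g hg => by
  rw [map_mul, hp g hg, hq g hg, smul_mul_smul_comm, pow_add]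

theorem one_mem_semiInvariants : (1 : MvPolynomial (Fin r × Fin s) ℚ) ∈ semiInvariants r s 0 :=
  fun g _ => by rw [map_one, pow_zero, one_smul]

theorem pow_mem_semiInvariants {n : ℕ} {p : MvPolynomial (Fin r × Fin s) ℚ}
    (hp : p ∈ semiInvariants r s n) (t : ℕ) : p ^ t ∈ semiInvariants r s (t * n) := by
  induction t with
  | zero => simpa using one_mem_semiInvariants
  | succ t ih =>
    rw [pow_succ, Nat.succ_mul]
    exact mul_mem_semiInvariants ih hp

theorem prod_mem_semiInvariants {e : ℕ → MvPolynomial (Fin r × Fin s) ℚ}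
    (he : ∀ i, e i ∈ semiInvariants r s 1) (d : ℕ) :
    ∏ i ∈ Finset.range d, e i ∈ semiInvariants r s d := by
  induction d with
  | zero => simpa using one_mem_semiInvariants
  | succ t ih =>
    rw [Finset.prod_range_succ]
    exact mul_mem_semiInvariants ih (he t)

theorem colMinor_mem_semiInvariants (c : Fin r → Fin s) :
    colMinor (genericMatrix r s ℚ) c ∈ semiInvariants r s 1 := fun g _ => by
  have h := map_colMinor (leftAct (s := s) g).toRingHom (genericMatrix r s ℚ) c
  have h1 : (genericMatrix r s ℚ).map (leftAct (s := s) g).toRingHom =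
      g.map (C (σ := Fin r × Fin s)) * genericMatrix r s ℚ := by
    ext1 i j
    simp [genericMatrix, leftAct, Matrix.mul_apply]
  rw [h1, colMinor_mul] at h
  refine h.trans ?_
  rw [pow_one, smul_eq_C_mul, RingHom.map_det]
  rfl

theorem rankSum_mem_semiInvariants (j : ℕ) :
    rankSum (genericMatrix r s ℚ) j ∈ semiInvariants r s 1 :=
  sum_mem fun c _ => colMinor_mem_semiInvariants c

instance (n : ℕ) : FiniteDimensional ℚ (semiInvariants r s n) := by
  refine Submodule.finiteDimensional_of_le (S₂ := restrictTotalDegree (Fin r × Fin s) ℚ (r * n)) ?_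
  intro p hp
  rw [mem_restrictTotalDegree]
  refine Finset.sup_le fun m hm => ?_
  have h := hp ((2 : ℚ) • 1) (by simp)
  have h1 : leftAct ((2 : ℚ) • 1) p =
      ∑ m ∈ p.support, monomial m (2 ^ (m.sum fun _ k => k) * coeff m p) := by
    conv_lhs => rw [p.as_sum]
    rw [map_sum]
    refine Finset.sum_congr rfl fun m _ => ?_
    rw [leftAct, aeval_monomial]
    have : ∀ ij : Fin r × Fin s, (∑ l, C (((2 : ℚ) • (1 : Matrix (Fin r) (Fin r) ℚ)) ij.1 l) *
        X (l, ij.2) : MvPolynomial (Fin r × Fin s) ℚ) = C 2 * X ij := fun ij => by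
      rw [Finset.sum_eq_single ij.1]
      · simp
      · intro b _ hb
        simp [Matrix.one_apply_ne hb.symm]
      · simp
    simp only [this, mul_pow, Finsupp.prod_mul]
    rw [monomial_eq, C_mul, Finsupp.prod, Finset.prod_pow_eq_pow_sum, algebraMap_eq, map_pow]
    simp only [Finsupp.sum]
    ring
  have h2 := congrArg (coeff m) h
  rw [h1, coeff_sum, coeff_smul, Finset.sum_eq_single_of_mem m hm (fun b _ hb => by
    rw [coeff_monomial, if_neg hb]), coeff_monomial, if_pos rfl, smul_eq_mul] at h2
  have h3 := mul_right_cancel₀ (mem_support_iff.1 hm) h2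
  simp only [Matrix.det_smul, Matrix.det_one, mul_one, Fintype.card_fin, ← pow_mul] at h3
  have h4 : (2 : ℕ) ^ (m.sum fun _ k => k) = 2 ^ (r * n) := by exact_mod_cast h3
  exact (Nat.pow_right_injective le_rfl h4).le

end SemiInvariants

section Projection

open MvPolynomial

variable {r s : ℕ}

theorem fischer_adjoint_mem_semiInvariants {n w : ℕ} {f q q' : MvPolynomial (Fin r × Fin s) ℚ}
    (hf : f ∈ semiInvariants r s w) (hq : q ∈ semiInvariants r s (n + w))
    (h : ∀ p, fischer (p * f) q = fischer p q') : q' ∈ semiInvariants r s n := by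
  intro g hg
  refine fischer_nondegenerate fun p => ?_
  have hgt : g.transpose.det ≠ 0 := by rwa [Matrix.det_transpose]
  have h1 := fischer_leftAct g.transpose p q'
  rw [Matrix.transpose_transpose] at h1
  have h2 := fischer_leftAct g.transpose (p * f) q
  rw [Matrix.transpose_transpose, hq g hg, map_mul, hf _ hgt, Matrix.det_transpose,
    mul_smul_comm, map_smul, LinearMap.smul_apply, map_smul, h, h, h1, pow_add, smul_eq_mul,
    smul_eq_mul] at h2
  rw [map_smul, smul_eq_mul]
  have h3 : g.det ^ w ≠ 0 := pow_ne_zero _ hg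
  refine mul_left_cancel₀ h3 ?_
  rw [h2]
  ring

/-- A semi-invariant in the ideal spanned by semi-invariants `f i` is a combination of the `f i`
with semi-invariant coefficients. -/
theorem exists_eq_sum_mul_semiInvariants {ι : Type*} (S : Finset ι) {n w : ℕ}
    (f : ι → MvPolynomial (Fin r × Fin s) ℚ) (hf : ∀ i, f i ∈ semiInvariants r s w)
    {F : MvPolynomial (Fin r × Fin s) ℚ} (hF : F ∈ semiInvariants r s (n + w))
    (a : ι → MvPolynomial (Fin r × Fin s) ℚ) (h : F = ∑ i ∈ S, a i * f i) :
    ∃ b : ι → MvPolynomial (Fin r × Fin s) ℚ,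
      (∀ i, b i ∈ semiInvariants r s n) ∧ F = ∑ i ∈ S, b i * f i := by
  choose b hb hba using fun i => exists_fischer_projection (semiInvariants r s n) (a i)
  refine ⟨b, hb, ?_⟩
  set D := F - ∑ i ∈ S, b i * f i with hD
  have hDmem : D ∈ semiInvariants r s (n + w) :=
    sub_mem hF (sum_mem fun i _ => mul_mem_semiInvariants (hb i) (hf i))
  have hD0 : fischer D D = 0 := by
    have h1 : D = ∑ i ∈ S, (a i - b i) * f i := by
      rw [hD, h, ← Finset.sum_sub_distrib]
      simp only [sub_mul]
    conv_lhs => enter [1, 2]; rw [h1]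
    rw [map_sum, LinearMap.sum_apply]
    refine Finset.sum_eq_zero fun i _ => ?_
    obtain ⟨q', hq'⟩ := exists_fischer_adjoint (f i) D
    rw [hq', map_sub, LinearMap.sub_apply,
      hba i q' (fischer_adjoint_mem_semiInvariants (hf i) hDmem hq'), sub_self]
  exact sub_eq_zero.1 (fischer_self_eq_zero hD0)

end Projection

section Integrality

open MvPolynomial

variable {r s : ℕ} {L : Type} [Field L] [Algebra ℚ L]

theorem aeval_mul_of_mem_semiInvariants {n : ℕ} {p : MvPolynomial (Fin r × Fin s) ℚ}
    (hp : p ∈ semiInvariants r s n) {g : Matrix (Fin r) (Fin r) L} (hg : g.det ≠ 0)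
    (Y : Matrix (Fin r) (Fin s) L) :
    aeval (fun ij => (g * Y) ij.1 ij.2) p = g.det ^ n * aeval (fun ij => Y ij.1 ij.2) p := by
  let τ := (Fin r × Fin r) ⊕ (Fin r × Fin s)
  let G : Matrix (Fin r) (Fin r) (MvPolynomial τ ℚ) := Matrix.of fun i j => X (Sum.inl (i, j))
  let U : Matrix (Fin r) (Fin s) (MvPolynomial τ ℚ) := Matrix.of fun i j => X (Sum.inr (i, j))
  let P : MvPolynomial τ ℚ := G.det *
    (aeval (fun ij => (G * U) ij.1 ij.2) p - G.det ^ n * aeval (fun ij => U ij.1 ij.2) p)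
  have key : ∀ {F : Type} [Field F] [Algebra ℚ F] (h : Matrix (Fin r) (Fin r) F)
      (y : Matrix (Fin r) (Fin s) F),
      aeval (Sum.elim (fun ij => h ij.1 ij.2) (fun ij => y ij.1 ij.2)) P =
        h.det * (aeval (fun ij => (h * y) ij.1 ij.2) p -
          h.det ^ n * aeval (fun ij => y ij.1 ij.2) p) := by
    intro F _ _ h y
    set ψ := aeval (R := ℚ) (Sum.elim (fun ij : Fin r × Fin r => h ij.1 ij.2)
      (fun ij : Fin r × Fin s => y ij.1 ij.2)) with hψ
    have hG : ψ G.det = h.det := by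
      rw [AlgHom.map_det]
      congr 1
      ext i j
      simp [hψ, G]
    have hU : ∀ ij : Fin r × Fin s, ψ (U ij.1 ij.2) = y ij.1 ij.2 := fun ij => by simp [hψ, U]
    have hGU : ∀ ij : Fin r × Fin s, ψ ((G * U) ij.1 ij.2) = (h * y) ij.1 ij.2 := fun ij => by
      simp [hψ, U, G, Matrix.mul_apply]
    simp only [P, map_mul, map_sub, map_pow, hG, ← AlgHom.comp_apply, comp_aeval]
    simp only [hU, hGU]
  have hP : P = 0 := by
    refine MvPolynomial.funext fun x => ?_
    let h : Matrix (Fin r) (Fin r) ℚ := Matrix.of fun i j => x (Sum.inl (i, j))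
    let y : Matrix (Fin r) (Fin s) ℚ := Matrix.of fun i j => x (Sum.inr (i, j))
    have h1 := key h y
    have hx : Sum.elim (fun ij : Fin r × Fin r => h ij.1 ij.2)
      (fun ij : Fin r × Fin s => y ij.1 ij.2) = x := by
      ext (_ | _) <;> rfl
    rw [hx, aeval_eq_eval] at h1
    refine h1.trans ?_
    rw [map_zero]
    by_cases hh : h.det = 0
    · rw [hh, zero_mul]
    · have h2 := congrArg (aeval (R := ℚ) fun ij => y ij.1 ij.2) (hp h hh)
      rw [leftAct, ← AlgHom.comp_apply, comp_aeval, map_smul, smul_eq_mul] at h2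
      rw [← h2, mul_eq_zero, sub_eq_zero]
      right
      congr 2
      ext ij
      simp [Matrix.mul_apply]
  have h3 := key g Y
  rw [hP, map_zero, eq_comm, mul_eq_zero, or_iff_right hg, sub_eq_zero] at h3
  exact h3

theorem colMinor_update_of_submatrix_eq_one {T : Type*} [CommRing T] {Y : Matrix (Fin r) (Fin s) T}
    {a : Fin r → Fin s} (hYa : Y.submatrix id a = 1) (i : Fin r) (j : Fin s) :
    colMinor Y (Function.update a i j) = Y i j := by
  have h1 : Y.submatrix id (Function.update a i j) =
      (1 : Matrix (Fin r) (Fin r) T).updateCol i (fun l => Y l j) := by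
    rw [← hYa]
    ext l m
    by_cases hm : m = i
    · subst hm; simp
    · simp [hm]
  rw [colMinor, h1, ← Matrix.cramer_apply, Matrix.cramer_one]
  rfl

theorem aeval_mem_valuationSubring (V : ValuationSubring L) (hV : ∀ q : ℚ, algebraMap ℚ L q ∈ V)
    {Z : Matrix (Fin r) (Fin s) L} (hZ : ∃ c, colMinor Z c ≠ 0)
    (he : ∀ j ≤ r * (s - r), rankSum Z j ∈ V) {n : ℕ} {p : MvPolynomial (Fin r × Fin s) ℚ}
    (hp : p ∈ semiInvariants r s n) : aeval (fun ij => Z ij.1 ij.2) p ∈ V := by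
  obtain ⟨c, hc⟩ := hZ
  have : Nonempty (Fin r → Fin s) := ⟨c⟩
  obtain ⟨a, ha⟩ := Finite.exists_max fun c => V.valuation (colMinor Z c)
  have ha0 : colMinor Z a ≠ 0 := by
    intro h
    have h1 := ha c
    rw [h, map_zero, le_zero_iff, map_eq_zero] at h1
    exact hc h1
  set g : Matrix (Fin r) (Fin r) L := Z.submatrix id a with hg
  have hgdet : g.det = colMinor Z a := rfl
  have hgu : IsUnit g.det := isUnit_iff_ne_zero.2 ha0
  set Y := g⁻¹ * Z with hY
  have hgY : g * Y = Z := by rw [hY, Matrix.mul_nonsing_inv_cancel_left _ _ hgu]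
  have hminor : ∀ c, colMinor Z c = g.det * colMinor Y c := fun c => by
    rw [← colMinor_mul, hgY]
  have hYV : ∀ c, colMinor Y c ∈ V := fun c => by
    have h1 : colMinor Y c = colMinor Z c / colMinor Z a := by
      rw [hminor c, hgdet, mul_div_cancel_left₀ _ ha0]
    rw [← V.valuation_le_one_iff, h1, map_div₀]
    exact div_le_one_of_le₀ (ha c) zero_le
  have hYa : Y.submatrix id a = 1 := by
    rw [hY, ← Matrix.nonsing_inv_mul g hgu]
    ext i j
    simp [hg, Matrix.mul_apply]
  have hYe : ∀ i j, Y i j ∈ V := fun i j => colMinor_update_of_submatrix_eq_one hYa i j ▸ hYV _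
  have hdet : g.det ∈ V := by
    by_contra hgV
    have hlt : 1 < V.valuation g.det := by
      rw [← not_le, V.valuation_le_one_iff]; exact hgV
    let W : Matrix (Fin r) (Fin s) V := Matrix.of fun i j => ⟨Y i j, hYe i j⟩
    have hW : W.map V.subtype = Y := rfl
    let res := IsLocalRing.residue V
    have h0 : ∀ j ≤ r * (s - r), rankSum (W.map res) j = 0 := by
      intro j hj
      rw [← map_rankSum, IsLocalRing.residue_eq_zero_iff, V.valuation_lt_one_iff]
      have h2 : ((rankSum W j : V) : L) = rankSum Y j := by
        rw [← hW, ← map_rankSum]; rfl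
      rw [h2]
      have h3 : V.valuation (rankSum Z j) ≤ 1 := (V.valuation_le_one_iff _).2 (he j hj)
      rw [← hgY, rankSum_mul, map_mul] at h3
      by_contra hcon
      rw [not_lt] at hcon
      exact absurd h3 (not_le.2 (lt_of_lt_of_le hlt (le_mul_of_one_le_right' hcon)))
    have h4 := colMinor_eq_zero_of_rankSum_eq_zero _ h0 a
    rw [← map_colMinor] at h4
    have h5 : colMinor W a = 1 := by
      apply Subtype.ext
      have h6 : ((colMinor W a : V) : L) = colMinor Y a := by
        rw [← hW, ← map_colMinor]; rfl
      rw [h6, colMinor, hYa, Matrix.det_one]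
      rfl
    rw [h5, map_one] at h4
    exact one_ne_zero h4
  have hfin := aeval_mul_of_mem_semiInvariants hp ha0 Y
  rw [hgY] at hfin
  rw [hfin]
  refine V.mul_mem _ _ (pow_mem hdet n) ?_
  rw [aeval_def, eval₂_eq]
  exact sum_mem fun m _ => V.mul_mem _ _ (hV _) (prod_mem fun i _ => pow_mem (hYe _ _) _)

theorem isIntegral_aeval_of_mem_semiInvariants {P : Type} [CommRing P] [Algebra ℚ P] [Algebra P L]
    [IsScalarTower ℚ P L] {Z : Matrix (Fin r) (Fin s) L} (hZ : ∃ c, colMinor Z c ≠ 0)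
    (he : ∀ j ≤ r * (s - r), rankSum Z j ∈ (algebraMap P L).range) {n : ℕ}
    {p : MvPolynomial (Fin r × Fin s) ℚ} (hp : p ∈ semiInvariants r s n) :
    IsIntegral P (aeval (fun ij => Z ij.1 ij.2) p) := by
  have h1 : aeval (fun ij => Z ij.1 ij.2) p ∈
      ⨅ V : {V : ValuationSubring L // ((algebraMap P L).range : Set L) ⊆ V.toSubring},
        V.1.toSubring := by
    rw [Subring.mem_iInf]
    rintro ⟨V, hV⟩
    refine aeval_mem_valuationSubring V (fun q => hV ⟨algebraMap ℚ P q, ?_⟩) hZ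
      (fun j hj => hV (he j hj)) hp
    rw [← IsScalarTower.algebraMap_apply]
  rw [iInf_valuationSubring_superset, Subring.closure_eq] at h1
  let _ : Algebra P (algebraMap P L).range := (algebraMap P L).rangeRestrict.toAlgebra
  have : IsScalarTower P (algebraMap P L).range L := IsScalarTower.of_algebraMap_eq fun _ => rfl
  have : Algebra.IsIntegral P (algebraMap P L).range :=
    ⟨fun x => by
      obtain ⟨y, rfl⟩ := (algebraMap P L).rangeRestrict_surjective x
      exact isIntegral_algebraMap⟩
  exact isIntegral_trans _ h1

end Integrality

section Contraction

theorem exists_eq_sum_of_isIntegral_of_finite {P K E ι : Type*} [CommRing P] [IsDomain P]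
    [IsIntegrallyClosed P] [Algebra ℚ P] [Field K] [Algebra P K] [IsFractionRing P K]
    [Field E] [Algebra K E] [Algebra P E] [IsScalarTower P K E] [FiniteDimensional K E]
    [Fintype ι] (F : P) (f : ι → P) (a : ι → E) (ha : ∀ i, IsIntegral P (a i))
    (h : algebraMap P E F = ∑ i, algebraMap P E (f i) * a i) :
    ∃ b : ι → P, F = ∑ i, f i * b i := by
  choose c hc using fun i => IsIntegrallyClosed.isIntegral_iff.1
    (Algebra.isIntegral_trace (L := K) (ha i))
  have h2 := congrArg (Algebra.trace K E) h
  rw [IsScalarTower.algebraMap_apply P K E, Algebra.trace_algebraMap, map_sum] at h2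
  have h3 : ∀ i, Algebra.trace K E (algebraMap P E (f i) * a i) = algebraMap P K (f i * c i) :=
    fun i => by
      rw [← Algebra.smul_def, ← algebraMap_smul K (f i), map_smul, map_mul, hc, smul_eq_mul]
  simp only [h3] at h2
  rw [← map_nsmul, ← map_sum] at h2
  have h4 := IsFractionRing.injective P K h2
  set m := Module.finrank K E
  have hm : (m : ℚ) ≠ 0 := by exact_mod_cast Module.finrank_pos.ne'
  refine ⟨fun i => (m : ℚ)⁻¹ • c i, ?_⟩
  simp only [mul_smul_comm]
  rw [← Finset.smul_sum, ← h4, ← Nat.cast_smul_eq_nsmul ℚ, smul_smul, inv_mul_cancel₀ hm, one_smul]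

/-- Ideals of a normal domain of characteristic zero are contracted from integral extensions. -/
theorem exists_eq_sum_of_isIntegral {P L ι : Type*} [CommRing P] [IsDomain P]
    [IsIntegrallyClosed P] [Algebra ℚ P] [Field L] [Algebra P L] [FaithfulSMul P L]
    [Fintype ι] (F : P) (f : ι → P) (a : ι → L) (ha : ∀ i, IsIntegral P (a i))
    (h : algebraMap P L F = ∑ i, algebraMap P L (f i) * a i) :
    ∃ b : ι → P, F = ∑ i, f i * b i := by
  let _ : Algebra (FractionRing P) L := FractionRing.liftAlgebra P L
  have : IsScalarTower P (FractionRing P) L := FractionRing.isScalarTower_liftAlgebra P L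
  have : FiniteDimensional (FractionRing P)
      (IntermediateField.adjoin (FractionRing P) (Set.range a)) := by
    have := (Set.finite_range a).to_subtype
    refine IntermediateField.finiteDimensional_adjoin ?_
    rintro _ ⟨i, rfl⟩
    exact (ha i).tower_top
  let _ : Algebra P (IntermediateField.adjoin (FractionRing P) (Set.range a)) :=
    ((algebraMap (FractionRing P) _).comp (algebraMap P (FractionRing P))).toAlgebra
  have : IsScalarTower P (FractionRing P)
      (IntermediateField.adjoin (FractionRing P) (Set.range a)) :=
    IsScalarTower.of_algebraMap_eq fun x => rfl
  have hval : ∀ x : P, ((algebraMap P (IntermediateField.adjoin (FractionRing P) (Set.range a)) x :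
      IntermediateField.adjoin (FractionRing P) (Set.range a)) : L) = algebraMap P L x :=
    fun x => (IsScalarTower.algebraMap_apply P (FractionRing P) L x).symm
  have : IsScalarTower P (IntermediateField.adjoin (FractionRing P) (Set.range a)) L :=
    IsScalarTower.of_algebraMap_eq fun x => (hval x).symm
  refine exists_eq_sum_of_isIntegral_of_finite (K := FractionRing P) F f
    (fun i => (⟨a i, IntermediateField.subset_adjoin _ _ ⟨i, rfl⟩⟩ :
      IntermediateField.adjoin (FractionRing P) (Set.range a))) (fun i => ?_) ?_
  · exact (isIntegral_algebraMap_iff (algebraMap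
      (IntermediateField.adjoin (FractionRing P) (Set.range a)) L).injective).1 (ha i)
  · apply Subtype.ext
    rw [hval, h]
    push_cast
    simp only [hval]

end Contraction

section Monomials

open MvPolynomial

theorem prod_X_pow_ne_sum {d N : ℕ} (b : Fin d → MvPolynomial (Fin d) ℚ) :
    (∏ i, X i : MvPolynomial (Fin d) ℚ) ^ N ≠ ∑ i, X i ^ (N + 1) * b i := by
  intro h
  let m : Fin d →₀ ℕ := Finsupp.equivFunOnFinite.symm fun _ => N
  have h1 : (∏ i, X i : MvPolynomial (Fin d) ℚ) ^ N = monomial m 1 := by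
    rw [monomial_eq, C_1, one_mul, ← Finset.prod_pow,
      Finsupp.prod_fintype _ _ (fun i => pow_zero _)]
    rfl
  have h2 := congrArg (coeff m) h
  rw [h1, coeff_monomial, if_pos rfl, coeff_sum, Finset.sum_eq_zero] at h2
  · exact one_ne_zero h2
  · intro i _
    rw [mul_comm, X_pow_eq_monomial, coeff_mul_monomial', if_neg]
    intro hle
    have := hle i
    simp [m] at this

end Monomials

section GenericPoint

open MvPolynomial

variable {r s : ℕ}

theorem genericMatrix_map_aeval {T : Type*} [CommRing T] [Algebra ℚ T]
    (Z : Matrix (Fin r) (Fin s) T) :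
    (genericMatrix r s ℚ).map (aeval fun ij : Fin r × Fin s => Z ij.1 ij.2).toRingHom = Z := by
  ext i j
  simp [genericMatrix]

theorem aeval_colMinor {T : Type*} [CommRing T] [Algebra ℚ T] (Z : Matrix (Fin r) (Fin s) T)
    (c : Fin r → Fin s) :
    aeval (fun ij => Z ij.1 ij.2) (colMinor (genericMatrix r s ℚ) c) = colMinor Z c := by
  conv_rhs => rw [← genericMatrix_map_aeval Z, ← map_colMinor]
  rfl

theorem aeval_rankSum {T : Type*} [CommRing T] [Algebra ℚ T] (Z : Matrix (Fin r) (Fin s) T)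
    (j : ℕ) :
    aeval (fun ij => Z ij.1 ij.2) (rankSum (genericMatrix r s ℚ) j) = rankSum Z j := by
  conv_rhs => rw [← genericMatrix_map_aeval Z, ← map_rankSum]
  rfl

/-- The function field of the affine cone over the Grassmannian. -/
abbrev ConeField (r s : ℕ) : Type :=
  FractionRing (MvPolynomial (Option (Fin r × Fin (s - r))) ℚ)

/-- The matrix `(1 | Y)` in a chart of the Grassmannian. -/
noncomputable def chartMatrix (r s : ℕ) : Matrix (Fin r) (Fin s) (ConeField r s) :=
  Matrix.of fun i j =>
    if h : r ≤ (j : ℕ) then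
      algebraMap (MvPolynomial (Option (Fin r × Fin (s - r))) ℚ) (ConeField r s)
        (X (some (i, ⟨j - r, by omega⟩)))
    else if (i : ℕ) = j then 1 else 0

/-- The coordinate along the cone. -/
noncomputable def coneCoord (r s : ℕ) : ConeField r s :=
  algebraMap (MvPolynomial (Option (Fin r × Fin (s - r))) ℚ) (ConeField r s) (X none)

theorem coneCoord_ne_zero : coneCoord r s ≠ 0 := by
  rw [coneCoord, Ne, FaithfulSMul.algebraMap_eq_zero_iff]
  exact X_ne_zero none

/-- A matrix whose maximal minors are the coordinates of a generic point of the cone over the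
Grassmannian. -/
noncomputable def coneMatrix (r s : ℕ) : Matrix (Fin r) (Fin s) (ConeField r s) :=
  (coneCoord r s • (1 : Matrix (Fin r) (Fin r) (ConeField r s))) * chartMatrix r s

theorem colMinor_coneMatrix (c : Fin r → Fin s) :
    colMinor (coneMatrix r s) c = coneCoord r s ^ r * colMinor (chartMatrix r s) c := by
  rw [coneMatrix, colMinor_mul, Matrix.det_smul, Matrix.det_one, mul_one, Fintype.card_fin]

theorem chartMatrix_submatrix (h : r ≤ s) :
    (chartMatrix r s).submatrix id (Fin.castLE h) = 1 := by
  ext i j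
  have : ¬ r ≤ (j : ℕ) := by omega
  simp [chartMatrix, this, Matrix.one_apply, Fin.ext_iff]

theorem colMinor_chartMatrix (h : r ≤ s) : colMinor (chartMatrix r s) (Fin.castLE h) = 1 := by
  rw [colMinor, chartMatrix_submatrix, Matrix.det_one]

theorem exists_colMinor_coneMatrix_ne_zero (h : r ≤ s) :
    ∃ c, colMinor (coneMatrix r s) c ≠ 0 :=
  ⟨Fin.castLE h, by
    rw [colMinor_coneMatrix, colMinor_chartMatrix, mul_one]
    exact pow_ne_zero _ coneCoord_ne_zero⟩

theorem isAlgebraic_of_forall_rankSum_mem (hr : 0 < r) (h : r ≤ s)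
    (B : Subalgebra ℚ (ConeField r s))
    (hB : ∀ j ≤ r * (s - r), rankSum (coneMatrix r s) j ∈ B) :
    Algebra.IsAlgebraic B (ConeField r s) := by
  have hminor : ∀ c, IsAlgebraic B (colMinor (coneMatrix r s) c) := fun c => by
    rw [← aeval_colMinor]
    exact (isIntegral_aeval_of_mem_semiInvariants (P := B) (exists_colMinor_coneMatrix_ne_zero h)
      (fun j hj => ⟨⟨_, hB j hj⟩, rfl⟩) (colMinor_mem_semiInvariants c)).isAlgebraic
  have hzr : IsAlgebraic B (coneCoord r s ^ r) := by
    have := hminor (Fin.castLE h)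
    rwa [colMinor_coneMatrix, colMinor_chartMatrix, mul_one] at this
  have hz : IsAlgebraic B (coneCoord r s) := hzr.of_pow hr
  have hy : ∀ i j, IsAlgebraic B (chartMatrix r s i j) := fun i j => by
    have h1 := (hminor (Function.update (Fin.castLE h) i j)).mul (IsAlgebraic.inv_iff.2 hzr)
    rwa [colMinor_coneMatrix, colMinor_update_of_submatrix_eq_one (chartMatrix_submatrix h),
      mul_comm, inv_mul_cancel_left₀ (pow_ne_zero _ coneCoord_ne_zero)] at h1
  have hS : ∀ x : MvPolynomial (Option (Fin r × Fin (s - r))) ℚ,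
      IsAlgebraic B (algebraMap _ (ConeField r s) x) := by
    intro x
    induction x using MvPolynomial.induction_on with
    | C a =>
      have : algebraMap _ (ConeField r s) (C a : MvPolynomial (Option (Fin r × Fin (s - r))) ℚ) =
          algebraMap B _ (algebraMap ℚ B a) := by
        rw [← algebraMap_eq, ← IsScalarTower.algebraMap_apply, ← IsScalarTower.algebraMap_apply]
      rw [this]
      exact isAlgebraic_algebraMap _
    | add p q hp hq => rw [map_add]; exact hp.add hq
    | mul_X p i hp =>
      rw [map_mul]
      refine hp.mul ?_
      rcases i with _ | ⟨i, j⟩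
      · exact hz
      · have h1 := hy i ⟨j + r, by omega⟩
        simpa [chartMatrix] using h1
  refine ⟨fun x => ?_⟩
  obtain ⟨a, b, _, rfl⟩ := IsFractionRing.div_surjective
    (A := MvPolynomial (Option (Fin r × Fin (s - r))) ℚ) x
  rw [div_eq_mul_inv]
  exact (hS a).mul (IsAlgebraic.inv_iff.2 (hS b))

theorem algebraicIndependent_rankSum_coneMatrix (hr : 0 < r) (h : r ≤ s) :
    AlgebraicIndependent ℚ
      (fun j : Fin (r * (s - r) + 1) => rankSum (coneMatrix r s) j) := by
  have := isAlgebraic_of_forall_rankSum_mem hr h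
    (Algebra.adjoin ℚ (Set.range fun j : Fin (r * (s - r) + 1) => rankSum (coneMatrix r s) j))
    (fun j hj => Algebra.subset_adjoin ⟨⟨j, by omega⟩, rfl⟩)
  refine (Algebra.IsAlgebraic.isTranscendenceBasis_of_le_trdeg_of_finite ℚ _ ?_).1
  have h1 := ((algebraicIndependent_X (Option (Fin r × Fin (s - r))) ℚ).map'
    (f := IsScalarTower.toAlgHom ℚ _ (ConeField r s))
    (IsFractionRing.injective _ _)).cardinalMk_le_trdeg
  refine le_trans (le_of_eq ?_) h1
  simp

end GenericPoint

section Nonvanishing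

open MvPolynomial

theorem prod_rankSum_pow_notMem {r s : ℕ} (hr : 0 < r) (hrs : r < s) (N : ℕ) :
    (∏ i ∈ Finset.range (r * (s - r) + 1), rankSum (genericMatrix r s ℚ) i) ^ N ∉
      initialIdeal (fun i => rankSum (genericMatrix r s ℚ) i ^ (N + 1)) (r * (s - r) + 1) := by
  intro h0
  have h := prod_pow_mul_mem_initialIdeal _ _ 1 _ h0
  rw [pow_one, ← pow_succ'] at h
  clear h0
  set M := N + 1 with hM
  have hd : 2 ≤ r * (s - r) + 1 := by
    have := Nat.mul_pos hr (Nat.sub_pos_of_lt hrs)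
    omega
  generalize hdd : r * (s - r) + 1 = d at h hd
  have hindep := algebraicIndependent_rankSum_coneMatrix hr hrs.le
  rw [hdd] at hindep
  have hrange : (fun i => rankSum (genericMatrix r s ℚ) i ^ (M + 1)) '' Set.Iio d =
      Set.range fun i : Fin d => rankSum (genericMatrix r s ℚ) i ^ (M + 1) := by
    ext x
    constructor
    · rintro ⟨i, hi, rfl⟩
      exact ⟨⟨i, hi⟩, rfl⟩
    · rintro ⟨i, rfl⟩
      exact ⟨i, i.2, rfl⟩
  rw [initialIdeal_eq_span, hrange, Ideal.mem_span_range_iff_exists_fun] at h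
  obtain ⟨a, ha⟩ := h
  have hle : M + 1 ≤ M * d := by
    calc M + 1 ≤ M + M := by omega
      _ = M * 2 := by ring
      _ ≤ M * d := Nat.mul_le_mul_left _ hd
  obtain ⟨n, hn⟩ := Nat.exists_eq_add_of_le' hle
  have hF := pow_mem_semiInvariants (prod_mem_semiInvariants
    (rankSum_mem_semiInvariants (r := r) (s := s)) d) M
  rw [hn] at hF
  obtain ⟨b, hb, hFb⟩ := exists_eq_sum_mul_semiInvariants Finset.univ
    (fun i : Fin d => rankSum (genericMatrix r s ℚ) i ^ (M + 1))
    (fun i => by simpa using pow_mem_semiInvariants (rankSum_mem_semiInvariants (i : ℕ)) (M + 1))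
    hF a ha.symm
  let _ : Algebra (MvPolynomial (Fin d) ℚ) (ConeField r s) :=
    (aeval fun j : Fin d => rankSum (coneMatrix r s) j).toRingHom.toAlgebra
  have hX : ∀ i : Fin d, algebraMap (MvPolynomial (Fin d) ℚ) (ConeField r s) (X i) =
      rankSum (coneMatrix r s) i := fun i => aeval_X _ _
  have := IsScalarTower.of_algebraMap_eq (R := ℚ) (S := MvPolynomial (Fin d) ℚ) (A := ConeField r s)
      fun q => (aeval_C _ q).symm
  have : FaithfulSMul (MvPolynomial (Fin d) ℚ) (ConeField r s) :=
    (faithfulSMul_iff_algebraMap_injective _ _).2 hindep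
  obtain ⟨c, hc⟩ := exists_eq_sum_of_isIntegral (P := MvPolynomial (Fin d) ℚ)
    (L := ConeField r s) ((∏ i, X i) ^ M) (fun i => X i ^ (M + 1))
    (fun i => aeval (fun ij : Fin r × Fin s => coneMatrix r s ij.1 ij.2) (b i))
    (fun i => isIntegral_aeval_of_mem_semiInvariants (exists_colMinor_coneMatrix_ne_zero hrs.le)
      (fun j hj => ⟨X ⟨j, by omega⟩, hX _⟩) (hb i))
    (by
      have h1 := congrArg (aeval fun ij : Fin r × Fin s => coneMatrix r s ij.1 ij.2) hFb
      simp only [map_pow, map_prod, map_sum, map_mul, aeval_rankSum] at h1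
      simp only [map_pow, map_prod, hX]
      rw [← Fin.prod_univ_eq_prod_range] at h1
      rw [h1]
      exact Finset.sum_congr rfl fun i _ => mul_comm _ _)
  exact prod_X_pow_ne_sum c hc

/-- Ideals of a polynomial ring are contracted from field extensions. -/
theorem mem_span_of_map_mem_span {σ F k : Type*} [Field F] [Field k] [Algebra F k]
    {S : Set (MvPolynomial σ F)} {x : MvPolynomial σ F}
    (h : map (algebraMap F k) x ∈ Ideal.span (map (algebraMap F k) '' S)) : x ∈ Ideal.span S := by
  classical
  obtain ⟨π, hπ⟩ := (Algebra.linearMap F k).exists_leftInverse_of_injective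
    (LinearMap.ker_eq_bot.2 (algebraMap F k).injective)
  have hπ1 : ∀ a, π (algebraMap F k a) = a := fun a => LinearMap.congr_fun hπ a
  let Φ : MvPolynomial σ k → MvPolynomial σ F := fun a =>
    ∑ m ∈ a.support, monomial m (π (coeff m a))
  have hΦ : ∀ a m, coeff m (Φ a) = π (coeff m a) := fun a m => by
    simp only [Φ, coeff_sum, coeff_monomial]
    rw [Finset.sum_ite_eq']
    split_ifs with hm
    · rfl
    · rw [notMem_support_iff.1 hm, map_zero]
  have hmul : ∀ a p, Φ (a * map (algebraMap F k) p) = Φ a * p := fun a p => by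
    ext m
    rw [hΦ, coeff_mul, coeff_mul, map_sum]
    refine Finset.sum_congr rfl fun ij _ => ?_
    rw [coeff_map, mul_comm, ← Algebra.smul_def, map_smul, hΦ, smul_eq_mul, mul_comm]
  have hx : Φ (map (algebraMap F k) x) = x := by
    ext m
    rw [hΦ, coeff_map, hπ1]
  rw [← hx]
  refine Submodule.span_induction (p := fun y _ => ∀ a, Φ (a * y) ∈ Ideal.span S) ?_ ?_ ?_ ?_ h 1
    |> fun h => by rwa [one_mul] at h
  · rintro _ ⟨y, hy, rfl⟩ a
    rw [hmul]
    exact Ideal.mul_mem_left _ _ (Ideal.subset_span hy)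
  · intro a
    have : Φ (a * 0) = 0 := by ext m; rw [hΦ]; simp
    rw [this]
    exact zero_mem _
  · intro y z _ _ hy hz a
    have : Φ (a * (y + z)) = Φ (a * y) + Φ (a * z) := by
      ext m
      rw [coeff_add, hΦ, hΦ, hΦ, mul_add, coeff_add, map_add]
    rw [this]
    exact add_mem (hy a) (hz a)
  · intro b y _ hy a
    rw [smul_eq_mul, ← mul_assoc]
    exact hy _

theorem genericMatrix_map_map {r s : ℕ} (F k : Type*) [Field F] [Field k] [Algebra F k] :
    (genericMatrix r s F).map (map (algebraMap F k)) = genericMatrix r s k := by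
  ext1 i j
  simp [genericMatrix]

theorem prod_rankSum_pow_notMem_of_charZero {k : Type} [Field k] [CharZero k] {r s : ℕ}
    (hr : 0 < r) (hrs : r < s) (N : ℕ) :
    (∏ i ∈ Finset.range (r * (s - r) + 1), rankSum (genericMatrix r s k) i) ^ N ∉
      initialIdeal (fun i => rankSum (genericMatrix r s k) i ^ (N + 1)) (r * (s - r) + 1) := by
  intro h
  refine prod_rankSum_pow_notMem hr hrs N ?_
  rw [initialIdeal_eq_span] at h ⊢
  apply mem_span_of_map_mem_span (k := k)
  rw [← genericMatrix_map_map ℚ k] at h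
  simp only [← map_rankSum] at h
  rw [map_pow, map_prod, ← Set.image_comp]
  simpa only [Function.comp_def, map_pow] using h

end Nonvanishing

/-- Let `k` be a field of characteristic zero, `X` an `r × s` matrix of indeterminates
with `r < s`, `R = k[X]`, `I` the ideal of maximal (`r × r`) minors, and
`d = r(s−r) + 1`.  Then `H^d_I(R) ≠ 0` and `H^i_I(R) = 0` for all `i > d`. -/
theorem stmt_13 {k : Type} [Field k] [CharZero k] (r s : ℕ) (hr : 0 < r) (hrs : r < s) :
    ¬ Subsingleton
        ((localCohomology
            (minorsIdeal (Matrix.of fun (i : Fin r) (j : Fin s) =>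
              (MvPolynomial.X (i, j) : MvPolynomial (Fin r × Fin s) k)) r)
            (r * (s - r) + 1)).obj
          (ModuleCat.of (MvPolynomial (Fin r × Fin s) k) (MvPolynomial (Fin r × Fin s) k)))
    ∧ ∀ i : ℕ, r * (s - r) + 1 < i →
        Subsingleton
          ((localCohomology
              (minorsIdeal (Matrix.of fun (i : Fin r) (j : Fin s) =>
                (MvPolynomial.X (i, j) : MvPolynomial (Fin r × Fin s) k)) r) i).obj
            (ModuleCat.of (MvPolynomial (Fin r × Fin s) k)
              (MvPolynomial (Fin r × Fin s) k))) := by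
  have hrad := minorsIdeal_radical_eq (genericMatrix r s k)
  have hiso := fun i => (localCohomology.isoOfSameRadical hrad i).app
    (ModuleCat.of (MvPolynomial (Fin r × Fin s) k) (MvPolynomial (Fin r × Fin s) k))
  refine ⟨fun h => ?_, fun i hi => ?_⟩
  · obtain ⟨N, hN⟩ := exists_prod_pow_mem_of_subsingleton_localCohomology
      (rankSum (genericMatrix r s k)) (r * (s - r))
      (@Equiv.subsingleton _ _ (hiso _).toLinearEquiv.symm.toEquiv h)
    exact prod_rankSum_pow_notMem_of_charZero hr hrs N hN
  · have := subsingleton_localCohomology_initialIdeal (rankSum (genericMatrix r s k))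
      (r * (s - r) + 1) i hi
      (ModuleCat.of (MvPolynomial (Fin r × Fin s) k) (MvPolynomial (Fin r × Fin s) k))
    exact (hiso i).toLinearEquiv.toEquiv.subsingleton
end

section
/- Let k be a field, R an ℕ-graded ring finitely generated over R₀ = k with homogeneous maximal ideal 𝔪 generated by x₁, ..., x_n, and M a ℤ-graded Artinian injective R-module supported only at 𝔪 with socle V = Soc M = Ann_M(𝔪) of finite k-dimension α. Then the graded dual M^∨ is a free R-module of rank α, and M^∨/𝔪M^∨ ≅ V* as k-vector spaces. -/
section Auxiliary

open DirectSum

/-- A linear map vanishing on all components but the `j`-th only depends on the `j`-th component. -/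
theorem DirectSum.apply_eq_apply_decompose {k M N ι : Type*} [Semiring k] [AddCommMonoid M]
    [AddCommMonoid N] [Module k M] [Module k N] [DecidableEq ι] (ℳ : ι → Submodule k M)
    [Decomposition ℳ] (f : M →ₗ[k] N) (j : ι) (hf : ∀ i ≠ j, ∀ u ∈ ℳ i, f u = 0) (u : M) :
    f u = f (decompose ℳ u j) := by
  induction u using Decomposition.inductionOn ℳ with
  | zero => simp
  | @homogeneous i m =>
    by_cases h : i = j
    · subst h; simp
    · rw [hf i h _ m.2, decompose_of_mem_ne ℳ m.2 h, map_zero]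
  | add a b ha hb => simp [ha, hb]

/-- A family of functionals separating the points of a finite-dimensional space exhausts the
dual space. -/
theorem LinearMap.surjective_of_separating {k X W : Type*} [Field k] [AddCommGroup X] [Module k X]
    [AddCommGroup W] [Module k W] [FiniteDimensional k W] (g : X →ₗ[k] Module.Dual k W)
    (hg : ∀ w, (∀ x, g x w = 0) → w = 0) : Function.Surjective g := by
  rw [← LinearMap.flip_injective_iff₂, ← LinearMap.ker_eq_bot, LinearMap.ker_eq_bot']
  intro w hw
  exact hg w fun x => by simpa using LinearMap.congr_fun hw x

/-- A map out of an `I`-power torsion module is injective if it is injective on the elements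
annihilated by `I`. -/
theorem LinearMap.injective_of_injective_on_socle {R X Y : Type*} [CommRing R] [AddCommGroup X]
    [AddCommGroup Y] [Module R X] [Module R Y] (I : Ideal R)
    (hX : ∀ u : X, ∃ e : ℕ, ∀ p ∈ I ^ e, p • u = 0) (g : X →ₗ[R] Y)
    (hg : ∀ u, (∀ p ∈ I, p • u = 0) → g u = 0 → u = 0) : Function.Injective g := by
  rw [← LinearMap.ker_eq_bot, LinearMap.ker_eq_bot']
  have key : ∀ (e : ℕ) (u : X), (∀ p ∈ I ^ e, p • u = 0) → g u = 0 → u = 0 := by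
    intro e
    induction e with
    | zero => intro u hu _; simpa using hu 1 (by simp)
    | succ e ih =>
      intro u hu h0
      refine ih u (fun p hp => hg _ (fun r hr => ?_) (by simp [h0])) h0
      rw [smul_smul, mul_comm]
      exact hu _ (pow_succ I e ▸ Ideal.mul_mem_mul hp hr)
  intro u hu
  obtain ⟨e, he⟩ := hX u
  exact key e u he hu

/-- An injective map from an injective module to an `I`-power torsion module whose range contains
all elements annihilated by `I` is surjective. -/
theorem Module.Baer.surjective_of_socle_le_range {R M E : Type*} [CommRing R] [AddCommGroup M]
    [AddCommGroup E] [Module R M] [Module R E] (hM : Module.Baer R M) (I : Ideal R)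
    (hE : ∀ u : E, ∃ e : ℕ, ∀ p ∈ I ^ e, p • u = 0) (Φ : M →ₗ[R] E)
    (hΦ : Function.Injective Φ) (hsoc : ∀ u : E, (∀ p ∈ I, p • u = 0) → ∃ m, Φ m = u) :
    Function.Surjective Φ := by
  obtain ⟨ψ, hψ⟩ := Module.Baer.extension_property hM Φ hΦ LinearMap.id
  have hψ' : ∀ m, ψ (Φ m) = m := fun m => LinearMap.congr_fun hψ m
  have hinj : Function.Injective ψ := by
    refine LinearMap.injective_of_injective_on_socle I hE ψ fun u hu h0 => ?_
    obtain ⟨m, rfl⟩ := hsoc u hu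
    rw [hψ'] at h0
    simp [h0]
  exact fun u => ⟨ψ u, hinj (hψ' _)⟩

/-- The contragredient module structure on the `k`-dual of a module over a `k`-algebra. -/
abbrev Module.Dual.contragredient (k R F : Type*) [Field k] [CommRing R] [Algebra k R]
    [AddCommGroup F] [Module k F] [Module R F] [IsScalarTower k R F] :
    Module R (Module.Dual k F) where
  smul r f := f ∘ₗ Algebra.lsmul k k F r
  one_smul f := LinearMap.ext fun v => congrArg f (one_smul R v)
  mul_smul r s f := LinearMap.ext fun v => congrArg f (by simp [mul_comm r s])
  smul_zero r := rfl
  smul_add r f g := rfl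
  add_smul r s f := LinearMap.ext fun v => (congrArg f (add_smul r s v)).trans (map_add f _ _)
  zero_smul f := LinearMap.ext fun v => (congrArg f (zero_smul R v)).trans (map_zero f)

/-- Let `M` be an injective `I`-power torsion module with a map `T` to the `k`-dual of a module
`F`, injective on the elements annihilated by `I`, whose range contains all functionals vanishing
on `I F`.  Then `T` is injective and its range contains all functionals vanishing on some
`I ^ e F`. -/
theorem Module.Baer.injective_and_exists_eq_of_vanishing {k R M F : Type*} [Field k] [CommRing R] [Algebra k R]
    [AddCommGroup M] [Module k M] [Module R M]
    [AddCommGroup F] [Module k F] [Module R F] [IsScalarTower k R F]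
    (hM : Module.Baer R M) (I : Ideal R) (hI : ∀ u : M, ∃ e : ℕ, ∀ p ∈ I ^ e, p • u = 0)
    (T : M →ₗ[k] Module.Dual k F) (hTR : ∀ (r : R) u v, T (r • u) v = T u (r • v))
    (hT : ∀ u, (∀ p ∈ I, p • u = 0) → T u = 0 → u = 0)
    (hsoc : ∀ f : Module.Dual k F, (∀ p ∈ I, ∀ v : F, f (p • v) = 0) → ∃ u, T u = f) :
    Function.Injective T ∧ ∀ (f : Module.Dual k F) (e : ℕ),
      (∀ p ∈ I ^ e, ∀ v : F, f (p • v) = 0) → ∃ u, T u = f := by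
  let _ := Module.Dual.contragredient k R F
  have hsmul : ∀ (r : R) (f : Module.Dual k F) (v : F), (r • f) v = f (r • v) := fun _ _ _ => rfl
  let E : Submodule R (Module.Dual k F) :=
    { carrier := {f | ∃ e : ℕ, ∀ p ∈ I ^ e, p • f = 0}
      zero_mem' := ⟨0, fun p _ => smul_zero p⟩
      add_mem' := by
        rintro f g ⟨a, ha⟩ ⟨b, hb⟩
        refine ⟨max a b, fun p hp => ?_⟩
        rw [smul_add, ha p (Ideal.pow_le_pow_right (le_max_left a b) hp),
          hb p (Ideal.pow_le_pow_right (le_max_right a b) hp), add_zero]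
      smul_mem' := by
        rintro r f ⟨a, ha⟩
        exact ⟨a, fun p hp => by rw [smul_comm, ha p hp, smul_zero]⟩ }
  let T' : M →ₗ[R] Module.Dual k F :=
    { toFun := T
      map_add' := map_add T
      map_smul' := fun r u => LinearMap.ext fun v => hTR r u v }
  have hT' : Function.Injective T' := LinearMap.injective_of_injective_on_socle I hI T' hT
  let Φ : M →ₗ[R] E := T'.codRestrict E fun u => by
    obtain ⟨a, ha⟩ := hI u
    exact ⟨a, fun p hp => by rw [← map_smul, ha p hp, map_zero]⟩
  have hΦ : Function.Surjective Φ := by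
    refine hM.surjective_of_socle_le_range (E := E) I ?_ Φ ?_ ?_
    · rintro ⟨u, a, ha⟩
      exact ⟨a, fun p hp => Subtype.ext (ha p hp)⟩
    · intro u v huv
      exact hT' (congrArg Subtype.val huv)
    · rintro ⟨u, hu⟩ h
      obtain ⟨m, hm⟩ := hsoc u fun p hp v =>
        LinearMap.congr_fun (congrArg Subtype.val (h p hp)) v
      exact ⟨m, Subtype.ext hm⟩
  refine ⟨hT', fun f e hf => ?_⟩
  obtain ⟨u, hu⟩ := hΦ ⟨f, e, fun p hp => LinearMap.ext fun v => hf p hp v⟩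
  exact ⟨u, congrArg Subtype.val hu⟩

/-- If `R = k + I` with `I` finitely generated and `I`-adically separated, then `R` is as small
as `k`. -/
theorem Ideal.small_of_separated.{w, u, v} {k : Type u} {R : Type v} [Field k] [CommRing R]
    [Algebra k R] [Small.{w} k] (I : Ideal R) (hfg : I.FG)
    (hk : ∀ r : R, ∃ c : k, r - algebraMap k R c ∈ I)
    (hsep : ∀ r : R, (∀ e : ℕ, r ∈ I ^ e) → r = 0) : Small.{w} R := by
  obtain ⟨n, x, hx⟩ := Submodule.fg_iff_exists_fin_generating_family.mp hfg
  have key : ∀ e : ℕ, Small.{w} (R ⧸ I ^ e) := by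
    intro e
    induction e with
    | zero =>
      have : Subsingleton (R ⧸ I ^ 0) := Ideal.Quotient.subsingleton_iff.mpr (by simp)
      infer_instance
    | succ e ih =>
      refine small_of_surjective (α := k × (Fin n → R ⧸ I ^ e))
        (f := fun z => Ideal.Quotient.mk (I ^ (e + 1))
          (algebraMap k R z.1 + ∑ i, (z.2 i).out * x i)) fun q => ?_
      obtain ⟨r, rfl⟩ := Ideal.Quotient.mk_surjective q
      obtain ⟨c, hc⟩ := hk r
      rw [← hx, Submodule.mem_span_range_iff_exists_fun] at hc
      obtain ⟨s, hs⟩ := hc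
      refine ⟨(c, fun i => Ideal.Quotient.mk _ (s i)), ?_⟩
      rw [Ideal.Quotient.mk_eq_mk_iff_sub_mem]
      have : algebraMap k R c + ∑ i, (Ideal.Quotient.mk (I ^ e) (s i)).out * x i - r
          = ∑ i, ((Ideal.Quotient.mk (I ^ e) (s i)).out - s i) * x i := by
        simp only [sub_mul, Finset.sum_sub_distrib]
        simp only [smul_eq_mul] at hs
        rw [hs]; ring
      rw [this, pow_succ]
      refine Ideal.sum_mem _ fun i _ => Ideal.mul_mem_mul ?_ ?_
      · rw [← Ideal.Quotient.mk_eq_mk_iff_sub_mem]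
        exact Quotient.out_eq _
      · rw [← hx]; exact Submodule.subset_span ⟨i, rfl⟩
  refine small_of_injective (β := ∀ e : ℕ, R ⧸ I ^ e)
    (f := fun r e => Ideal.Quotient.mk (I ^ e) r) fun r s h => ?_
  refine sub_eq_zero.mp (hsep _ fun e => ?_)
  rw [← Ideal.Quotient.mk_eq_mk_iff_sub_mem]
  exact congrFun h e

/-- Under the hypotheses of `Ideal.small_of_separated`, an injective module satisfies Baer's
criterion irrespective of universe levels. -/
theorem Module.Injective.baer_of_separated {k R M : Type*} [Field k] [CommRing R] [Algebra k R]
    [AddCommGroup M] [Module R M] [Module k M] (I : Ideal R)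
    (hfg : I.FG) (hk : ∀ r : R, ∃ c : k, r - algebraMap k R c ∈ I)
    (hsep : ∀ r : R, (∀ e : ℕ, r ∈ I ^ e) → r = 0) (hM : Module.Injective R M) :
    Module.Baer R M := by
  rcases subsingleton_or_nontrivial M with h | h
  · exact fun J g => ⟨0, fun x hx => Subsingleton.elim _ _⟩
  · obtain ⟨u, hu⟩ := exists_ne (0 : M)
    have : Small k := small_of_injective (f := fun c : k => c • u) (smul_left_injective k hu)
    have := Ideal.small_of_separated (k := k) I hfg hk hsep
    exact Module.Baer.of_injective hM

section Graded

variable {k R M : Type*} [Field k] [CommRing R] [Algebra k R]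
  (𝒜 : ℤ → Submodule k R) [GradedAlgebra 𝒜]

/-- In an `ℕ`-graded algebra with `R₀ = k`, every element is congruent to a constant modulo the
irrelevant ideal. -/
theorem GradedAlgebra.exists_sub_algebraMap_mem (hAneg : ∀ i : ℤ, i < 0 → 𝒜 i = ⊥)
    (hA0 : 𝒜 0 = (1 : Submodule k R)) (𝔪 : Ideal R)
    (hm : ∀ i : ℤ, 0 < i → ∀ a ∈ 𝒜 i, a ∈ 𝔪) (r : R) :
    ∃ c : k, r - algebraMap k R c ∈ 𝔪 := by
  induction r using Decomposition.inductionOn 𝒜 with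
  | zero => exact ⟨0, by simp⟩
  | @homogeneous i a =>
    rcases lt_trichotomy i 0 with h | rfl | h
    · have ha : (a : R) = 0 := (Submodule.mem_bot k).mp ((hAneg i h).le a.2)
      exact ⟨0, by simp [ha]⟩
    · obtain ⟨c, hc⟩ := Submodule.mem_one.mp (hA0.le a.2)
      exact ⟨c, by simp [hc]⟩
    · exact ⟨0, by simpa using hm i h a a.2⟩
  | add a b ha hb =>
    obtain ⟨c, hc⟩ := ha
    obtain ⟨d, hd⟩ := hb
    refine ⟨c + d, ?_⟩
    rw [map_add, add_sub_add_comm]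
    exact add_mem hc hd

/-- The elements of the `e`-th power of the irrelevant ideal have no components of degree
less than `e`. -/
theorem GradedAlgebra.decompose_eq_zero_of_mem_pow (hAneg : ∀ i : ℤ, i < 0 → 𝒜 i = ⊥)
    (𝔪 : Ideal R) (h𝔪 : 𝔪 = Ideal.span (⋃ i ∈ {i : ℤ | 0 < i}, (𝒜 i : Set R))) (e : ℕ) :
    ∀ r ∈ 𝔪 ^ e, ∀ i : ℤ, i < e → (decompose 𝒜 r i : R) = 0 := by
  induction e with
  | zero =>
    intro r _ i hi
    exact (Submodule.mem_bot k).mp ((hAneg i (by simpa using hi)).le (decompose 𝒜 r i).2)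
  | succ e ih =>
    intro r hr
    rw [pow_succ, mul_comm] at hr
    induction hr using Submodule.mul_induction_on' with
    | mem_mul_mem p hp q hq =>
      rw [h𝔪] at hp
      induction hp using Submodule.span_induction generalizing q with
      | mem a ha =>
        simp only [Set.mem_ofPred_eq, Set.mem_iUnion, SetLike.mem_coe] at ha
        obtain ⟨j, hj, ha⟩ := ha
        intro i hi
        have := coe_decompose_mul_add_of_left_mem 𝒜 (j := i - j) (b := q) ha
        rw [add_sub_cancel] at this
        rw [this, ih q hq _ (by push_cast at hi; omega), mul_zero]
      | zero => intro i _; simp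
      | add a b _ _ ha hb =>
        intro i hi
        rw [add_mul, decompose_add, DirectSum.add_apply, Submodule.coe_add, ha q hq i hi,
          hb q hq i hi, add_zero]
      | smul s a _ ha =>
        intro i hi
        have : s • a * q = a * (s * q) := by rw [smul_eq_mul]; ring
        rw [this]
        exact ha _ (Ideal.mul_mem_left _ s hq) i hi
    | add a _ b _ ha hb => intro i hi; simp [decompose_add, ha i hi, hb i hi]

theorem GradedAlgebra.eq_zero_of_forall_mem_pow (hAneg : ∀ i : ℤ, i < 0 → 𝒜 i = ⊥)
    (𝔪 : Ideal R) (h𝔪 : 𝔪 = Ideal.span (⋃ i ∈ {i : ℤ | 0 < i}, (𝒜 i : Set R))) (r : R)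
    (hr : ∀ e : ℕ, r ∈ 𝔪 ^ e) : r = 0 := by
  classical
  rw [← sum_support_decompose 𝒜 r]
  refine Finset.sum_eq_zero fun i _ => ?_
  exact decompose_eq_zero_of_mem_pow 𝒜 hAneg 𝔪 h𝔪 (i.toNat + 1) r (hr _) i (by omega)

variable [AddCommGroup M] [Module R M] [Module k M] [IsScalarTower k R M]
    (ℳ : ℤ → Submodule k M) [Decomposition ℳ] [SetLike.GradedSMul 𝒜 ℳ]

omit [GradedAlgebra 𝒜] [IsScalarTower k R M] in
theorem GradedAlgebra.decompose_smul_of_mem {l : ℤ} {r : R} (hr : r ∈ 𝒜 l) (u : M) (i : ℤ) :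
    (decompose ℳ (r • u) i : M) = r • (decompose ℳ u (i - l) : M) := by
  induction u using Decomposition.inductionOn ℳ with
  | zero => simp
  | @homogeneous j m =>
    have hm : r • (m : M) ∈ ℳ (l + j) := SetLike.GradedSMul.smul_mem hr m.2
    by_cases h : l + j = i
    · subst h
      rw [decompose_of_mem_same ℳ hm, add_sub_cancel_left, decompose_of_mem_same ℳ m.2]
    · rw [decompose_of_mem_ne ℳ hm h, decompose_of_mem_ne ℳ m.2 (by omega), smul_zero]
  | add a b ha hb => simp [decompose_add, ha, hb]

/-- The homogeneous components of a graded Artinian module over an `ℕ`-graded algebra with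
`R₀ = k` are finite-dimensional. -/
theorem GradedAlgebra.finiteDimensional_of_isArtinian (hAneg : ∀ i : ℤ, i < 0 → 𝒜 i = ⊥)
    (hA0 : 𝒜 0 = (1 : Submodule k R)) [IsArtinian R M] (l : ℤ) :
    FiniteDimensional k (ℳ l) := by
  let G : Submodule k (ℳ l) → Submodule R M := fun W =>
    { carrier := {u | (∀ i < l, (decompose ℳ u i : M) = 0) ∧ decompose ℳ u l ∈ W}
      zero_mem' := by simp
      add_mem' := by
        rintro a b ⟨ha, ha'⟩ ⟨hb, hb'⟩
        refine ⟨fun i hi => by simp [decompose_add, ha i hi, hb i hi], ?_⟩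
        simpa [decompose_add] using add_mem ha' hb'
      smul_mem' := by
        rintro r u ⟨hu, hu'⟩
        induction r using Decomposition.inductionOn 𝒜 with
        | zero => simp
        | @homogeneous j a =>
          rcases lt_trichotomy j 0 with h | rfl | h
          · have ha : (a : R) = 0 := (Submodule.mem_bot k).mp ((hAneg j h).le a.2)
            simp [ha]
          · obtain ⟨c, hc⟩ := Submodule.mem_one.mp (hA0.le a.2)
            rw [← hc, algebraMap_smul]
            refine ⟨fun i hi => ?_, ?_⟩
            · rw [← algebraMap_smul R c u, hc, decompose_smul_of_mem 𝒜 ℳ a.2, sub_zero, hu i hi,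
                smul_zero]
            · rw [decompose_smul]
              exact W.smul_mem c hu'
          · refine ⟨fun i hi => ?_, ?_⟩
            · rw [decompose_smul_of_mem 𝒜 ℳ a.2, hu _ (by omega), smul_zero]
            · have : decompose ℳ ((a : R) • u) l = 0 := Subtype.ext (by
                rw [decompose_smul_of_mem 𝒜 ℳ a.2, hu _ (by omega), smul_zero]; rfl)
              rw [this]; exact W.zero_mem
        | add a b ha hb =>
          rw [add_smul]
          refine ⟨fun i hi => by simp [decompose_add, ha.1 i hi, hb.1 i hi], ?_⟩
          simpa [decompose_add] using add_mem ha.2 hb.2 }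
  have hG : ∀ (W : Submodule k (ℳ l)) (u : ℳ l), (u : M) ∈ G W ↔ u ∈ W := by
    intro W u
    have h1 : ∀ i < l, (decompose ℳ (u : M) i : M) = 0 := fun i hi =>
      decompose_of_mem_ne ℳ u.2 hi.ne'
    have h2 : decompose ℳ (u : M) l = u := Subtype.ext (decompose_of_mem_same ℳ u.2)
    change (_ ∧ _) ↔ _
    rw [h2]
    exact and_iff_right h1
  have hmono : StrictMono G := by
    refine Monotone.strictMono_of_injective (fun W W' h u hu => ⟨hu.1, h hu.2⟩) fun W W' h => ?_
    ext u
    rw [← hG W, h, hG]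
  have : IsArtinian k (ℳ l) := hmono.wellFoundedLT
  exact (IsSemisimpleModule.finite_tfae.out 0 2).mpr this

end Graded

end Auxiliary


/-- Let `k` be a field, `R` an `ℕ`-graded Noetherian ring with `R₀ = k` and homogeneous
maximal ideal `𝔪 = (x₁, …, xₙ)`, and `M` a `ℤ`-graded Artinian injective `R`-module
supported only at `𝔪`, with socle `V = Ann_M 𝔪` of finite `k`-dimension `α`.  Let `D` be
the graded dual `M^∨` of `M` (encoded by a graded perfect pairing `B` between `D` and `M`
compatible with the `R`-actions).  Then `D = M^∨` is a free `R`-module of rank `α`, and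
`M^∨/𝔪M^∨ ≅ V*` as `k`-vector spaces. -/
theorem stmt_18 {k R M D : Type*} [Field k] [CommRing R] [IsNoetherianRing R] [Algebra k R]
    (𝒜 : ℤ → Submodule k R) [GradedAlgebra 𝒜]
    (hAneg : ∀ i : ℤ, i < 0 → 𝒜 i = ⊥) (hA0 : 𝒜 0 = (1 : Submodule k R))
    -- the homogeneous maximal ideal, generated by `x₁, …, xₙ`
    (𝔪 : Ideal R) (n : ℕ) (x : Fin n → R) (h𝔪 : 𝔪 = Ideal.span (Set.range x))
    (h𝔪max : 𝔪.IsMaximal)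
    (h𝔪irr : 𝔪 = Ideal.span (⋃ i ∈ {i : ℤ | 0 < i}, (𝒜 i : Set R)))
    -- `M` is a `ℤ`-graded Artinian injective `R`-module supported only at `𝔪`
    [AddCommGroup M] [Module R M] [Module k M] [IsScalarTower k R M]
    (ℳ : ℤ → Submodule k M) [DirectSum.Decomposition ℳ] [SetLike.GradedSMul 𝒜 ℳ]
    [IsArtinian R M] (hinj : Module.Injective R M)
    (hsupp : ∀ u : M, ∃ e : ℕ, ∀ p ∈ 𝔪 ^ e, p • u = 0)
    -- the socle `V = Soc M`, of finite dimension `α`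
    (V : Submodule k M) (hV : ∀ u : M, u ∈ V ↔ ∀ p ∈ 𝔪, p • u = 0)
    [FiniteDimensional k ↥V] (α : ℕ) (hα : Module.finrank k ↥V = α)
    -- `D` is the graded dual `M^∨`, encoded via a pairing `B : D × M → k`
    [AddCommGroup D] [Module R D] [Module k D] [IsScalarTower k R D]
    (𝒟 : ℤ → Submodule k D) [DirectSum.Decomposition 𝒟]
    (B : D →ₗ[k] M →ₗ[k] k)
    -- the pairing intertwines the `R`-module structures
    (hBR : ∀ (r : R) (d : D) (u : M), B (r • d) u = B d (r • u))
    -- the pairing is graded: `[M^∨]_j` pairs with `M_{−j}`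
    (horth : ∀ (j i : ℤ), i ≠ -j → ∀ d ∈ 𝒟 j, ∀ u ∈ ℳ i, B d u = 0)
    -- and perfect in each degree
    (hnd₁ : ∀ j : ℤ, ∀ d ∈ 𝒟 j, (∀ u ∈ ℳ (-j), B d u = 0) → d = 0)
    (hnd₂ : ∀ j : ℤ, ∀ u ∈ ℳ (-j), (∀ d ∈ 𝒟 j, B d u = 0) → u = 0) :
    -- conclusion: `M^∨` is free of rank `α` over `R`, and `M^∨/𝔪M^∨ ≅ V*`
    Module.Free R D ∧ Module.finrank R D = α ∧
    ∃ q : D →ₗ[k] Module.Dual k ↥V, Function.Surjective q ∧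
      LinearMap.ker q = Submodule.restrictScalars k (𝔪 • (⊤ : Submodule R D)) := by
  classical
  have hpos : ∀ i : ℤ, 0 < i → ∀ a ∈ 𝒜 i, a ∈ 𝔪 := fun i hi a ha => by
    rw [h𝔪irr]
    exact Ideal.subset_span (Set.mem_biUnion (x := i) hi ha)
  have hconst := GradedAlgebra.exists_sub_algebraMap_mem 𝒜 hAneg hA0 𝔪 hpos
  have hsep := GradedAlgebra.eq_zero_of_forall_mem_pow 𝒜 hAneg 𝔪 h𝔪irr
  have hBaer : Module.Baer R M :=
    Module.Injective.baer_of_separated 𝔪 (IsNoetherian.noetherian 𝔪) hconst hsep hinj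
  have hBD : ∀ (j : ℤ) (d : D), ∀ u ∈ ℳ (-j),
      B d u = B (DirectSum.decompose 𝒟 d j : D) u := fun j d u hu =>
    DirectSum.apply_eq_apply_decompose 𝒟 (B.flip u) j
      (fun i hi e he => horth i (-j) (by omega) e he u hu) d
  have hBM : ∀ (j : ℤ), ∀ d ∈ 𝒟 j, ∀ u : M,
      B d u = B d (DirectSum.decompose ℳ u (-j) : M) := fun j d hd u =>
    DirectSum.apply_eq_apply_decompose ℳ (B d) (-j)
      (fun i hi w hw => horth j i hi d hd w hw) u
  have hndD : ∀ d : D, (∀ u, B d u = 0) → d = 0 := fun d hd => by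
    rw [← DirectSum.sum_support_decompose 𝒟 d]
    refine Finset.sum_eq_zero fun j _ => hnd₁ j _ (SetLike.coe_mem _) fun u hu => ?_
    rw [← hBD j d u hu, hd]
  have hndM : ∀ u : M, (∀ d, B d u = 0) → u = 0 := fun u hu => by
    rw [← DirectSum.sum_support_decompose ℳ u]
    refine Finset.sum_eq_zero fun i _ => ?_
    obtain ⟨j, rfl⟩ : ∃ j, i = -j := ⟨-i, by simp⟩
    refine hnd₂ j _ (SetLike.coe_mem _) fun d hd => ?_
    rw [← hBM j d hd u, hu]
  have hsmulD : ∀ (l : ℤ), ∀ r ∈ 𝒜 l, ∀ (t : ℤ), ∀ d ∈ 𝒟 t, r • d ∈ 𝒟 (l + t) := by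
    intro l r hr t d hd
    suffices h : r • d - (DirectSum.decompose 𝒟 (r • d) (l + t) : D) = 0 by
      rw [sub_eq_zero.mp h]
      exact SetLike.coe_mem _
    refine hndD _ fun u => ?_
    rw [DirectSum.apply_eq_apply_decompose ℳ (B _) (-(l + t)) (fun i hi w hw => ?_) u]
    · rw [map_sub, LinearMap.sub_apply, ← hBD (l + t) _ _ (SetLike.coe_mem _), sub_self]
    · have hrw : r • w ∈ ℳ (l + i) := SetLike.GradedSMul.smul_mem hr hw
      rw [map_sub, LinearMap.sub_apply, hBR, horth t (l + i) (by omega) d hd _ hrw,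
        horth (l + t) i hi _ (SetLike.coe_mem _) w hw, sub_zero]
  let q : D →ₗ[k] Module.Dual k V := V.subtype.dualMap ∘ₗ B
  have hq : ∀ d (v : V), q d v = B d v := fun _ _ => rfl
  have hqsep : ∀ v : V, (∀ d, q d v = 0) → v = 0 := fun v hv => Subtype.ext (hndM v hv)
  have hqsurj : Function.Surjective q := LinearMap.surjective_of_separating q hqsep
  have hspan : Submodule.span k (q '' ⋃ j, (𝒟 j : Set D)) = ⊤ := by
    refine eq_top_iff.mpr fun φ _ => ?_
    obtain ⟨d, rfl⟩ := hqsurj φ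
    rw [← DirectSum.sum_support_decompose 𝒟 d, map_sum]
    exact Submodule.sum_mem _ fun j _ => Submodule.subset_span
      ⟨_, Set.mem_iUnion.mpr ⟨j, SetLike.coe_mem _⟩, rfl⟩
  obtain ⟨b, hbs, hbspan, hli⟩ := exists_linearIndependent k (q '' ⋃ j, (𝒟 j : Set D))
  have hbfin : Fintype b := hli.setFinite.fintype
  let bas : Module.Basis b k (Module.Dual k V) := Module.Basis.mk hli (by
    rw [Subtype.range_coe, hbspan, hspan])
  have hlift : ∀ i : b, ∃ (t : ℤ) (d : D), d ∈ 𝒟 t ∧ q d = bas i := by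
    intro i
    obtain ⟨d, hd, hdi⟩ := hbs i.2
    obtain ⟨t, ht⟩ := Set.mem_iUnion.mp hd
    exact ⟨t, d, ht, by rw [hdi, Module.Basis.mk_apply]⟩
  choose t d hd hqd using hlift
  let T₀ : (b → R) →ₗ[R] D := Fintype.linearCombination R d
  have hT₀ : ∀ (i : b) (r : R), T₀ (Pi.single i r) = r • d i := fun i r => by
    simp [T₀, Fintype.linearCombination_apply_single]
  let T : M →ₗ[k] Module.Dual k (b → R) := (T₀.restrictScalars k).dualMap ∘ₗ B.flip
  have hT : ∀ u v, T u v = B (T₀ v) u := fun _ _ => rfl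
  have hTR : ∀ (r : R) u v, T (r • u) v = T u (r • v) := fun r u v => by
    rw [hT, hT, T₀.map_smul, hBR]
  obtain ⟨hTinj, hTrange⟩ := hBaer.injective_and_exists_eq_of_vanishing 𝔪 hsupp T hTR
    (fun u hu h0 => by
      have hbu : Module.Dual.eval k V ⟨u, (hV u).mpr hu⟩ = 0 := bas.ext fun i => by
        rw [Module.Dual.eval_apply, ← hqd, hq, ← one_smul R (d i), ← hT₀, ← hT, h0]
        rfl
      have := hqsep ⟨u, (hV u).mpr hu⟩ fun d => LinearMap.congr_fun hbu (q d)
      exact congrArg Subtype.val this)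
    (fun f hf => by
      obtain ⟨v, hv⟩ := (Module.evalEquiv k V).surjective
        (bas.constr k fun i => f (Pi.single i (1 : R)))
      have hv' : ∀ i, B (d i) v = f (Pi.single i 1) := fun i => by
        have := LinearMap.congr_fun hv (bas i)
        rwa [Module.Basis.constr_basis, Module.evalEquiv_apply, Module.Dual.eval_apply,
          ← hqd, hq] at this
      refine ⟨v, LinearMap.pi_ext fun i r => ?_⟩
      obtain ⟨c, hc⟩ := hconst r
      obtain ⟨p, hp, rfl⟩ : ∃ p ∈ 𝔪, r = p + algebraMap k R c := ⟨_, hc, by ring⟩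
      have hsingle : (Pi.single i (p + algebraMap k R c) : b → R)
          = p • (Pi.single i 1 : b → R) + c • (Pi.single i 1 : b → R) := by
        rw [← Pi.single_smul, ← Pi.single_smul, ← Pi.single_add, smul_eq_mul, mul_one,
          Algebra.algebraMap_eq_smul_one]
      rw [hsingle, map_add, map_add, hf p hp, ← hTR, (hV v).mp v.2 p hp, map_zero,
        map_smul, map_smul, hT, hT₀, one_smul, hv']
      rfl)
  have hT₀inj : Function.Injective T₀ := by
    rw [← LinearMap.ker_eq_bot, LinearMap.ker_eq_bot']
    intro r hr
    funext i
    refine hsep _ fun e => ?_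
    by_contra hre
    obtain ⟨g, hg, hge⟩ := Submodule.exists_le_ker_of_notMem
      (p := (𝔪 ^ e).restrictScalars k) (v := r i) hre
    obtain ⟨u, hu⟩ := hTrange (g ∘ₗ LinearMap.proj i) e fun p hp v =>
      hge (Ideal.mul_mem_right (v i) _ hp)
    have := LinearMap.congr_fun hu r
    rw [hT, hr, map_zero] at this
    exact hg this.symm
  have hhom : ∀ (v : b → R) (j : ℤ),
      (DirectSum.decompose 𝒟 (T₀ v) j : D) ∈ LinearMap.range T₀ := by
    intro v j
    have hsingle : ∀ (i : b) (r : R),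
        (DirectSum.decompose 𝒟 (r • d i) j : D) ∈ LinearMap.range T₀ := by
      intro i r
      induction r using DirectSum.Decomposition.inductionOn 𝒜 with
      | zero => simp
      | @homogeneous l a =>
        have ha := hsmulD l a a.2 (t i) (d i) (hd i)
        by_cases h : l + t i = j
        · subst h
          rw [DirectSum.decompose_of_mem_same 𝒟 ha]
          exact ⟨_, hT₀ i a⟩
        · rw [DirectSum.decompose_of_mem_ne 𝒟 ha h]
          exact zero_mem _
      | add r s hr hs =>
        rw [add_smul, DirectSum.decompose_add, DirectSum.add_apply, Submodule.coe_add]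
        exact add_mem hr hs
    rw [Fintype.linearCombination_apply]
    refine Finset.sum_induction _
      (fun w => (DirectSum.decompose 𝒟 w j : D) ∈ LinearMap.range T₀) (fun w z hw hz => ?_) ?_
      fun i _ => hsingle i (v i)
    · rw [DirectSum.decompose_add, DirectSum.add_apply, Submodule.coe_add]
      exact add_mem hw hz
    · simp
  have hT₀surj : LinearMap.range T₀ = ⊤ := by
    refine eq_top_iff.mpr fun e _ => ?_
    rw [← DirectSum.sum_support_decompose 𝒟 e]
    refine Submodule.sum_mem _ fun j _ => ?_
    have := GradedAlgebra.finiteDimensional_of_isArtinian 𝒜 ℳ hAneg hA0 (-j)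
    obtain ⟨v, hv⟩ := LinearMap.surjective_of_separating
      ((ℳ (-j)).subtype.dualMap ∘ₗ B ∘ₗ T₀.restrictScalars k)
      (fun w hw => Subtype.ext (hTinj (a₂ := 0) (LinearMap.ext fun v => by
        rw [map_zero]; exact hw v)))
      ((ℳ (-j)).subtype.dualMap (B (DirectSum.decompose 𝒟 e j : D)))
    suffices h : (DirectSum.decompose 𝒟 e j : D) - DirectSum.decompose 𝒟 (T₀ v) j = 0 by
      rw [sub_eq_zero.mp h]
      exact hhom v j
    refine hnd₁ j _ (sub_mem (SetLike.coe_mem _) (SetLike.coe_mem _)) fun u hu => ?_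
    rw [map_sub, LinearMap.sub_apply, ← hBD j (T₀ v) u hu, sub_eq_zero]
    exact (LinearMap.congr_fun hv ⟨u, hu⟩).symm
  have : Nontrivial R := nontrivial_of_ne 0 1 fun h =>
    h𝔪max.ne_top ((Ideal.eq_top_iff_one 𝔪).mpr (h ▸ 𝔪.zero_mem))
  let basD : Module.Basis b R D := Module.Basis.ofEquivFun
    (LinearEquiv.ofBijective T₀ ⟨hT₀inj, LinearMap.range_eq_top.mp hT₀surj⟩).symm
  refine ⟨Module.Free.of_basis basD, ?_, q, hqsurj, le_antisymm (fun e he => ?_) fun e he => ?_⟩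
  · rw [Module.finrank_eq_card_basis basD, ← hα, ← Subspace.dual_finrank_eq,
      Module.finrank_eq_card_basis bas]
  · obtain ⟨r, rfl⟩ := LinearMap.range_eq_top.mp hT₀surj e
    choose c hc using fun i => hconst (r i)
    have hsmul : ∀ (p : R), p ∈ 𝔪 → ∀ z : D, q (p • z) = 0 := fun p hp z =>
      LinearMap.ext fun v => by
        rw [hq, hBR, (hV v).mp v.2 p hp, map_zero, LinearMap.zero_apply]
    have hsum : ∑ i, c i • bas i = 0 := by
      rw [← LinearMap.mem_ker.mp he, Fintype.linearCombination_apply, map_sum]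
      refine Finset.sum_congr rfl fun i _ => ?_
      have := hsmul _ (hc i) (d i)
      rwa [sub_smul, map_sub, algebraMap_smul, q.map_smul, hqd, sub_eq_zero, eq_comm] at this
    have hc0 := Fintype.linearIndependent_iff.mp bas.linearIndependent c hsum
    rw [Submodule.restrictScalars_mem, Fintype.linearCombination_apply]
    refine Submodule.sum_mem _ fun i _ => Submodule.smul_mem_smul ?_ Submodule.mem_top
    simpa [hc0 i] using hc i
  · rw [Submodule.restrictScalars_mem] at he
    induction he using Submodule.smul_induction_on' with
    | smul p hp z _ =>
      exact LinearMap.ext fun v => by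
        rw [hq, hBR, (hV v).mp v.2 p hp, map_zero, LinearMap.zero_apply]
    | add a _ b _ ha hb => exact add_mem ha hb
end
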